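/- arXiv:math/0208016 — 2 statements merged into one kernel-verified Lean document; each statement's English description precedes it below -/
import Mathlib

section
/- Let K be a compact polar subset of a domain D ⊆ ℂ and let f be holomorphic on D \ K. Then there exists a plurisubharmonic function u on D × ℂ such that e^u is continuous and {(z,w) ∈ D × ℂ : u(z,w) = -∞} = {(z, f(z)) : z ∈ D \ K} ∪ (K × ℂ). -/
open Set Metric MeasureTheory Filter Topology

noncomputable section

open Classical in
/-- The average of an `EReal`-valued function over the circle of center `z` and radius `r`;
it is `⊥` if the function equals `⊥` on a set of positive measure of the circle or if
its (finite) values are not integrable over the circle. -/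
def circleAvg (u : ℂ → EReal) (z : ℂ) (r : ℝ) : EReal :=
  if (IntervalIntegrable (fun θ : ℝ => (u (circleMap z r θ)).toReal) volume 0 (2 * Real.pi)
      ∧ ∀ᵐ θ ∂(volume.restrict (Set.Ioc (0:ℝ) (2 * Real.pi))), u (circleMap z r θ) ≠ ⊥)
  then (((∫ θ in (0:ℝ)..(2 * Real.pi), (u (circleMap z r θ)).toReal) / (2 * Real.pi) : ℝ) : EReal)
  else ⊥

/-- `u` is plurisubharmonic on a (typically open) set `Ω` of a complex vector space:
it takes values in `[-∞, ∞)`, is upper semicontinuous on `Ω`, is not identically `-∞`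
on any connected component of `Ω`, and its restriction to every complex line satisfies
the sub-mean value inequality on circles (whose closed discs lie in `Ω`). -/
def PSHOn {E : Type*} [NormedAddCommGroup E] [NormedSpace ℂ E]
    (u : E → EReal) (Ω : Set E) : Prop :=
  (∀ z ∈ Ω, u z ≠ ⊤) ∧
  UpperSemicontinuousOn u Ω ∧
  (∀ z ∈ Ω, ∃ w ∈ connectedComponentIn Ω z, u w ≠ ⊥) ∧
  ∀ a b : E, ∀ c : ℂ, ∀ r : ℝ, 0 < r →
    (∀ l ∈ Metric.closedBall c r, a + l • b ∈ Ω) →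
    u (a + c • b) ≤ circleAvg (fun l : ℂ => u (a + l • b)) c r

/-- In one complex variable, plurisubharmonic = subharmonic. -/
abbrev SubharmonicOn (u : ℂ → EReal) (Ω : Set ℂ) : Prop := PSHOn u Ω

/-- A set `P ⊆ ℂ` is polar if `P ⊆ {u = -∞}` for some subharmonic `u` on `ℂ`
(not identically `-∞`). -/
def PolarSet (P : Set ℂ) : Prop :=
  ∃ u : ℂ → EReal, SubharmonicOn u Set.univ ∧ ∀ z ∈ P, u z = ⊥

/-- `S` is pluripolar in `Ω`. -/
def PluripolarIn {E : Type*} [NormedAddCommGroup E] [NormedSpace ℂ E]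
    (S Ω : Set E) : Prop :=
  ∃ u : E → EReal, PSHOn u Ω ∧ ∀ z ∈ S, u z = ⊥

/-- `S` is complete pluripolar in `Ω`: `S` is exactly the `-∞`-set of some
plurisubharmonic function on `Ω`. -/
def CompletePluripolarIn {E : Type*} [NormedAddCommGroup E] [NormedSpace ℂ E]
    (S Ω : Set E) : Prop :=
  ∃ u : E → EReal, PSHOn u Ω ∧ ∀ z ∈ Ω, (u z = ⊥ ↔ z ∈ S)

/-- The pluripolar hull `S*_Ω` of `S` in `Ω`. -/
def pluripolarHull {E : Type*} [NormedAddCommGroup E] [NormedSpace ℂ E]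
    (S Ω : Set E) : Set E :=
  {z ∈ Ω | ∀ u : E → EReal, PSHOn u Ω → (∀ w ∈ S, u w = ⊥) → u z = ⊥}

/-- `S` is (pluri-)thin at `ζ`: either `ζ` is not a limit point of `S \ {ζ}`, or there is
a plurisubharmonic function on a neighborhood of `ζ` with
`limsup_{z → ζ, z ∈ S \ {ζ}} u z < u ζ`. -/
def PluriThinAt {E : Type*} [NormedAddCommGroup E] [NormedSpace ℂ E]
    (S : Set E) (ζ : E) : Prop :=
  ζ ∉ closure (S \ {ζ}) ∨
  ∃ U : Set E, IsOpen U ∧ ζ ∈ U ∧ ∃ u : E → EReal, PSHOn u U ∧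
    Filter.limsup u (nhdsWithin ζ (S \ {ζ})) < u ζ

/-- Thinness in `ℂ`. -/
abbrev ThinAt (S : Set ℂ) (ζ : ℂ) : Prop := PluriThinAt S ζ

/-- The relative extremal function (pluriharmonic measure) `ω(z, A, D)`:
`-sup { u(z) : u` psh on `D`, `u ≤ 0` on `D`, `u ≤ -1` on `A }`, where for points of `A`
not belonging to `D` the condition `u ≤ -1` is understood as
`limsup_{ζ → w, ζ ∈ D} u(ζ) ≤ -1` (for `w ∈ A ∩ D` and `u` upper semicontinuous the
condition below is equivalent to `u w ≤ -1`). -/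
def relExtremal {E : Type*} [NormedAddCommGroup E] [NormedSpace ℂ E]
    (z : E) (A D : Set E) : EReal :=
  - sSup {y : EReal | ∃ u : E → EReal, PSHOn u D ∧ (∀ w ∈ D, u w ≤ 0) ∧
      (∀ w ∈ A, Filter.limsup u (nhdsWithin w (insert w D)) ≤ -1) ∧ y = u z}

/-- `ζ` is a regular boundary point of `Ω` if `ζ ∈ ∂Ω` and `ℂ \ Ω` is non-thin at `ζ`. -/
def RegularBoundaryPoint (Ω : Set ℂ) (ζ : ℂ) : Prop :=
  ζ ∈ frontier Ω ∧ ¬ ThinAt Ωᶜ ζ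

/-- The graph `Γ_f = {(z, f z) : z ∈ S} ⊆ ℂ²` of `f` over `S`. -/
def graphOver (f : ℂ → ℂ) (S : Set ℂ) : Set (ℂ × ℂ) := {p | p.1 ∈ S ∧ p.2 = f p.1}

/-- `e^x` for `x ∈ [-∞, ∞)`, as a map to `[0, ∞)`. -/
def expEReal (x : EReal) : ℝ := if x = ⊥ then 0 else Real.exp x.toReal

end

open InnerProductSpace in
lemma aux_no_max {H : ℂ → ℝ} {z0 : ℂ} {η : ℝ} (hη : 0 < η) (hH : HarmonicAt H z0)
    (hmax : ∀ᶠ z in 𝓝 z0, H z + η * ‖z‖ ^ 2 ≤ H z0 + η * ‖z0‖ ^ 2) : False := by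
  have h2 := hmax.and hH.eventually
  obtain ⟨ρ, hρ, hball⟩ := Metric.nhds_basis_closedBall.eventually_iff.1 h2
  let L : ℂ → ℝ := fun z => η * (2 * ((starRingEnd ℂ z0) * z).re)
  have hL : ∀ z, HarmonicAt L z := by
    intro z
    have : AnalyticAt ℂ (fun z : ℂ => (2 * η : ℝ) * ((starRingEnd ℂ z0) * z)) z := by fun_prop
    have h3 := this.harmonicAt_re
    convert h3 using 2
    rw [Complex.re_ofReal_mul]; simp only [L]; ring
  have hHL : HarmonicOnNhd (H + L) (closedBall z0 |ρ|) := by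
    rw [abs_of_pos hρ]
    intro z hz
    exact (hball hz).2.add (hL z)
  have hav := hHL.circleAverage_eq
  have hci : CircleIntegrable (H + L) z0 ρ := by
    apply ContinuousOn.circleIntegrable'
    exact hHL.continuousOn.mono sphere_subset_closedBall
  have hle := Real.circleAverage_mono_on_of_le_circle (a := H z0 + L z0 - η * ρ ^ 2) hci (by
    intro z hz
    rw [abs_of_pos hρ] at hz
    have h4 := (hball (sphere_subset_closedBall hz)).1
    have h5 : ‖z - z0‖ = ρ := by simpa [dist_eq_norm] using hz
    have h6 : ‖z‖ ^ 2 = 2 * ((starRingEnd ℂ z0) * z).re - ‖z0‖ ^ 2 + ρ ^ 2 := by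
      rw [← h5, Complex.sq_norm, Complex.sq_norm, Complex.sq_norm, Complex.normSq_apply,
        Complex.normSq_apply, Complex.normSq_apply]
      simp; ring
    have h7 : ((starRingEnd ℂ z0) * z0).re = ‖z0‖ ^ 2 := by
      rw [Complex.sq_norm, Complex.normSq_apply]; simp
    simp only [Pi.add_apply, L, h7]
    rw [h6] at h4
    nlinarith)
  rw [hav] at hle
  have : 0 < η * ρ ^ 2 := by positivity
  simp only [Pi.add_apply] at hle
  linarith

open InnerProductSpace in
lemma aux_trig {φ : ℂ → ℝ} {c : ℂ} {r ε : ℝ} (hr : 0 < r) (hε : 0 < ε)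
    (hφ : ContinuousOn φ (sphere c r)) :
    ∃ h : ℂ → ℝ, (∀ z, HarmonicAt h z) ∧ ∀ z ∈ sphere c r, |φ z - h z| ≤ ε := by
  have : Fact (0 < 2 * Real.pi) := ⟨Real.two_pi_pos⟩
  let g : ℝ → ℂ := fun θ => (φ (circleMap c r θ) : ℂ)
  have hgper : Function.Periodic g (2 * Real.pi) := fun θ => by
    simp only [g, periodic_circleMap c r θ]
  have hgc : Continuous g := by
    apply Complex.continuous_ofReal.comp
    exact hφ.comp_continuous (continuous_circleMap c r) (fun θ => circleMap_mem_sphere c hr.le θ)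
  let G : C(AddCircle (2 * Real.pi), ℂ) := ⟨hgper.lift, continuous_coinduced_dom.mpr (by
    exact hgc)⟩
  have hG : ∀ θ : ℝ, G (θ : AddCircle (2 * Real.pi)) = φ (circleMap c r θ) := fun θ => rfl
  have hmem : G ∈ (Submodule.span ℂ (range (@fourier (2 * Real.pi)))).topologicalClosure := by
    rw [span_fourier_closure_eq_top]; trivial
  have hmem' : G ∈ closure ((Submodule.span ℂ (range (@fourier (2 * Real.pi))) : Submodule ℂ _) : Set _) := hmem
  obtain ⟨T, hT, hTd⟩ := Metric.mem_closure_iff.1 hmem' ε hε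
  have key : ∃ q₁ q₂ : ℂ → ℂ, Differentiable ℂ q₁ ∧ Differentiable ℂ q₂ ∧
      ∀ θ : ℝ, T (θ : AddCircle (2 * Real.pi)) =
        q₁ (circleMap c r θ) + starRingEnd ℂ (q₂ (circleMap c r θ)) := by
    clear hTd
    induction hT using Submodule.span_induction with
    | mem x h =>
      obtain ⟨n, rfl⟩ := h
      have hexp : ∀ θ : ℝ, (circleMap c r θ - c) / r = Complex.exp (θ * Complex.I) := by
        intro θ
        have : (r : ℂ) ≠ 0 := by exact_mod_cast hr.ne'
        simp only [circleMap]; field_simp; ring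
      obtain ⟨m, rfl | rfl⟩ := n.eq_nat_or_neg
      · refine ⟨fun z => ((z - c) / r) ^ m, fun _ => 0, by fun_prop, by fun_prop, fun θ => ?_⟩
        simp only
        rw [hexp, fourier_coe_apply, ← Complex.exp_nat_mul]
        simp
        congr 1
        have : (Real.pi : ℂ) ≠ 0 := by exact_mod_cast Real.pi_ne_zero
        field_simp
      · refine ⟨fun _ => 0, fun z => ((z - c) / r) ^ m, by fun_prop, by fun_prop, fun θ => ?_⟩
        simp only
        rw [hexp, fourier_coe_apply, ← Complex.exp_nat_mul, ← Complex.exp_conj]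
        simp
        congr 1
        have : (Real.pi : ℂ) ≠ 0 := by exact_mod_cast Real.pi_ne_zero
        field_simp
    | zero => exact ⟨0, 0, differentiable_const _, differentiable_const _, by simp⟩
    | add x y hx hy ihx ihy =>
      obtain ⟨a, b, ha, hb, hab⟩ := ihx
      obtain ⟨a', b', ha', hb', hab'⟩ := ihy
      exact ⟨a + a', b + b', ha.add ha', hb.add hb', fun θ => by
        simp [hab, hab']; ring⟩
    | smul k x hx ihx =>
      obtain ⟨a, b, ha, hb, hab⟩ := ihx
      refine ⟨fun z => k * a z, fun z => starRingEnd ℂ k * b z, by fun_prop, by fun_prop, fun θ => ?_⟩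
      simp [hab]; ring
  obtain ⟨q₁, q₂, hq₁, hq₂, hq⟩ := key
  refine ⟨fun z => ((q₁ + q₂) z).re, fun z => ?_, fun z hz => ?_⟩
  · exact ((hq₁.add hq₂).analyticAt z).harmonicAt_re
  · rw [← abs_of_pos hr, ← range_circleMap] at hz
    obtain ⟨θ, rfl⟩ := hz
    have h1 : ‖(G - T) (θ : AddCircle (2 * Real.pi))‖ ≤ ‖G - T‖ := ContinuousMap.norm_coe_le_norm _ _
    rw [dist_eq_norm] at hTd
    have h2 := (Complex.abs_re_le_norm ((G - T) (θ : AddCircle (2 * Real.pi)))).trans (h1.trans hTd.le)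
    rw [ContinuousMap.sub_apply, hG, hq] at h2
    simpa using h2

open InnerProductSpace in
lemma aux_loc_glob {φ : ℂ → ℝ} {c : ℂ} {r : ℝ} (hr : 0 < r)
    (hφ : ContinuousOn φ (closedBall c r))
    (hloc : ∀ z ∈ ball c r, ∃ ψ : ℂ → ℝ, HarmonicAt ψ z ∧ ψ z = φ z ∧ ∀ᶠ y in 𝓝 z, ψ y ≤ φ y) :
    φ c ≤ Real.circleAverage φ c r := by
  have hci : CircleIntegrable φ c r :=
    ContinuousOn.circleIntegrable hr.le (hφ.mono sphere_subset_closedBall)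
  suffices H : ∀ ε > 0, φ c ≤ Real.circleAverage φ c r + 4 * ε by
    apply le_of_forall_pos_le_add
    intro ε hε
    have := H (ε / 4) (by positivity)
    linarith
  intro ε hε
  obtain ⟨h, hh, hhφ⟩ := aux_trig hr hε (hφ.mono sphere_subset_closedBall)
  have hhc : Continuous h := by
    rw [← continuousOn_univ]
    exact HarmonicOnNhd.continuousOn (fun z _ => hh z)
  have hav : Real.circleAverage h c r = h c :=
    InnerProductSpace.HarmonicOnNhd.circleAverage_eq (fun z _ => hh z)
  have h1 : Real.circleAverage h c r ≤ Real.circleAverage φ c r + ε := by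
    rw [← Real.circleAverage_const ε c r, ← Real.circleAverage_fun_add hci (by simp)]
    apply Real.circleAverage_mono hhc.continuousOn.circleIntegrable'
    · exact hci.add (by simp)
    · intro x hx
      rw [abs_of_pos hr] at hx
      have := abs_le.1 (hhφ x hx)
      linarith
  -- maximum principle
  obtain ⟨C, hC⟩ : ∃ C : ℝ, 0 < C ∧ ∀ z ∈ closedBall c r, ‖z‖ ^ 2 ≤ C := by
    refine ⟨(‖c‖ + r) ^ 2, by positivity, fun z hz => ?_⟩
    have : ‖z‖ ≤ ‖c‖ + r := by
      have h3 : ‖z - c‖ ≤ r := by simpa [dist_eq_norm] using hz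
      have := norm_le_norm_add_norm_sub' z c
      linarith
    gcongr
  obtain ⟨hC0, hC⟩ := hC
  set η := ε / C with hηdef
  have hη : 0 < η := by positivity
  have hηC : η * C = ε := by rw [hηdef]; field_simp
  have hcont : ContinuousOn (fun z => φ z - h z + η * ‖z‖ ^ 2) (closedBall c r) := by fun_prop
  obtain ⟨zm, hzm, hmax⟩ := (isCompact_closedBall c r).exists_isMaxOn
    ⟨c, mem_closedBall_self hr.le⟩ hcont
  have hcm := hmax (mem_closedBall_self hr.le)
  simp only [mem_ofPred_eq] at hcm
  have hzmb : zm ∉ ball c r := by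
    intro hb
    obtain ⟨ψ, hψ, hψe, hψle⟩ := hloc zm hb
    refine aux_no_max hη (hψ.sub (hh zm)) ?_
    filter_upwards [hψle, isOpen_ball.mem_nhds hb] with y hy hyb
    have := hmax (ball_subset_closedBall hyb)
    simp only [mem_ofPred_eq] at this
    simp only [Pi.sub_apply, hψe]
    linarith
  have hzs : zm ∈ sphere c r := by
    simp only [mem_ball, not_lt, mem_closedBall, mem_sphere] at *
    linarith
  have h5 := (abs_le.1 (hhφ zm hzs)).2
  have h6 := hC zm hzm
  have h7 : η * ‖zm‖ ^ 2 ≤ ε := by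
    rw [← hηC]; gcongr
  have h8 : 0 ≤ η * ‖c‖ ^ 2 := by positivity
  linarith

lemma aux_energy {n : ℕ} (hn : 0 < n) (k : Fin n → Fin n → ℝ) (hk : ∀ i j, k i j = k j i) :
    ∃ (μ : Fin n → ℝ) (V : ℝ), (∀ i, 0 ≤ μ i) ∧ ∑ i, μ i = 1 ∧ (∀ i, ∑ j, μ j * k i j ≤ V) ∧
      (∀ i, μ i ≠ 0 → ∑ j, μ j * k i j = V) := by
  have : Nonempty (Fin n) := ⟨⟨0, hn⟩⟩
  let I : (Fin n → ℝ) → ℝ := fun μ => ∑ i, μ i * ∑ j, μ j * k i j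
  have hI : Continuous I := by fun_prop
  obtain ⟨μ, hμ, hmax⟩ := (isCompact_stdSimplex ℝ (Fin n)).exists_isMaxOn
    ⟨_, single_mem_stdSimplex ℝ (Classical.arbitrary (Fin n))⟩ hI.continuousOn
  have h1 : ∀ i, ∑ j, μ j * k i j ≤ I μ := by
    intro i
    set p : Fin n → ℝ := fun i => ∑ j, μ j * k i j with hp
    have hIp : I μ = ∑ i, μ i * p i := rfl
    by_contra hcon
    push Not at hcon
    let e : Fin n → ℝ := Pi.single i 1
    have hkey : ∀ t : ℝ, I (fun j => (1 - t) * μ j + t * e j) =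
        (1 - t) ^ 2 * I μ + 2 * t * (1 - t) * p i + t ^ 2 * k i i := by
      intro t
      have e1 : ∀ a, ∑ j, ((1 - t) * μ j + t * e j) * k a j = (1 - t) * p a + t * k a i := by
        intro a
        simp only [add_mul, Finset.sum_add_distrib, hp, Finset.mul_sum]
        congr 1
        · refine Finset.sum_congr rfl fun j _ => by ring
        · simp [e, Pi.single_apply]
      simp only [I, e1]
      have e2 : ∑ a, μ a * k a i = p i := by
        simp only [hp]; exact Finset.sum_congr rfl fun j _ => by rw [hk]
      have e3 : ∀ a, ((1 - t) * μ a + t * e a) * ((1 - t) * p a + t * k a i) =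
          (1 - t) ^ 2 * (μ a * p a) + t * (1 - t) * (μ a * k a i) +
          (t * (1 - t) * (e a * p a) + t ^ 2 * (e a * k a i)) := by intro a; ring
      simp only [e3, Finset.sum_add_distrib, ← Finset.mul_sum, e2]
      have e4 : ∑ a, e a * p a = p i := by simp [e, Pi.single_apply]
      have e5 : ∑ a, e a * k a i = k i i := by simp [e, Pi.single_apply]
      rw [e4, e5]; ring
    have hle : ∀ t : ℝ, 0 ≤ t → t ≤ 1 →
        (1 - t) ^ 2 * I μ + 2 * t * (1 - t) * p i + t ^ 2 * k i i ≤ I μ := by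
      intro t h0 h1
      rw [← hkey]
      apply hmax
      have := (convex_stdSimplex ℝ (Fin n)) hμ (single_mem_stdSimplex ℝ i) (sub_nonneg.2 h1) h0
        (by ring)
      exact this
    set d := p i - I μ with hd
    have hdpos : 0 < d := by simp only [hd]; linarith
    set q := I μ - 2 * p i + k i i with hq
    -- 2 t d + t^2 q ≤ 0
    have hle2 : ∀ t : ℝ, 0 < t → t ≤ 1 → 2 * d + t * q ≤ 0 := by
      intro t h0 h1
      have := hle t h0.le h1
      have h2 : t * (2 * d + t * q) ≤ 0 := by simp only [hd, hq]; nlinarith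
      by_contra h3
      push Not at h3
      have := mul_pos h0 h3
      linarith
    have hq1 := hle2 (min 1 (d / (|q| + 1))) (by positivity) (min_le_left _ _)
    have h5 : (min 1 (d / (|q| + 1))) * |q| ≤ d := by
      calc (min 1 (d / (|q| + 1))) * |q| ≤ d / (|q| + 1) * (|q| + 1) := by
            gcongr
            · exact min_le_right _ _
            · linarith
        _ = d := by field_simp
    have h6 : -((min 1 (d / (|q| + 1))) * |q|) ≤ (min 1 (d / (|q| + 1))) * q := by
      rw [← mul_neg]
      gcongr
      exact neg_abs_le q
    linarith
  refine ⟨μ, I μ, hμ.1, hμ.2, h1, fun i hi => ?_⟩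
  by_contra hne
  have hlt : ∑ j, μ j * k i j < I μ := lt_of_le_of_ne (h1 i) hne
  have : I μ < ∑ i, μ i * I μ := by
    apply Finset.sum_lt_sum
    · intro j _
      exact mul_le_mul_of_nonneg_left (h1 j) (hμ.1 j)
    · exact ⟨i, Finset.mem_univ _, mul_lt_mul_of_pos_left hlt (lt_of_le_of_ne (hμ.1 i) (Ne.symm hi))⟩
  rw [← Finset.sum_mul, hμ.2] at this
  linarith

open InnerProductSpace in
lemma aux_sq (z0 z : ℂ) : HarmonicAt (fun z : ℂ => ‖z‖ ^ 2 - ‖z - z0‖ ^ 2) z := by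
  have : AnalyticAt ℂ (fun z : ℂ => 2 * ((starRingEnd ℂ z0) * z) - (starRingEnd ℂ z0) * z0) z := by
    fun_prop
  have h3 := this.harmonicAt_re
  convert h3 using 2
  rw [Complex.sq_norm, Complex.sq_norm, Complex.normSq_apply, Complex.normSq_apply]
  simp; ring

open InnerProductSpace in
lemma aux_pot_harm {n : ℕ} (x : Fin n → ℂ) (μ : Fin n → ℝ) (z : ℂ) (hz : ∀ i, z ≠ x i) :
    HarmonicAt (fun z => ∑ i, μ i * Real.log ‖z - x i‖) z := by
  suffices H : ∀ s : Finset (Fin n), HarmonicAt (fun z => ∑ i ∈ s, μ i * Real.log ‖z - x i‖) z from H _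
  intro s
  induction s using Finset.induction_on with
  | empty => simp
  | insert a s ha ih =>
    simp only [Finset.sum_insert ha]
    refine HarmonicAt.add (HarmonicAt.const_smul (c := μ a) ?_) ih
    exact AnalyticAt.harmonicAt_log_norm (by fun_prop) (sub_ne_zero.2 (hz a))

open InnerProductSpace in
lemma aux_polar {K : Set ℂ} {u : ℂ → EReal} (hu : SubharmonicOn u Set.univ)
    (hK : IsCompact K) (huK : ∀ z ∈ K, u z = ⊥) (M : ℝ) :
    ∃ δ > 0, ∀ (n : ℕ) (x : Fin n → ℂ) (μ : Fin n → ℝ), (∀ i, x i ∈ K) → (∀ i, 0 ≤ μ i) →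
      ∑ i, μ i = 1 → ¬ (∀ z, z ∉ thickening δ K → -M ≤ ∑ i, μ i * Real.log ‖z - x i‖) := by
  obtain ⟨hutop, husc, hubot, hsub⟩ := hu
  obtain ⟨z0, -, hz0⟩ := hubot 0 trivial
  have hz0K : z0 ∉ K := fun h => hz0 (huK z0 h)
  set a := (u z0).toReal with ha
  have hua : u z0 = (a : EReal) := (EReal.coe_toReal (hutop z0 trivial) hz0).symm
  obtain ⟨C0, hC0pos, hC0⟩ : ∃ C0 : ℝ, 0 < C0 ∧ ∀ y ∈ K, ‖y‖ ≤ C0 := by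
    obtain ⟨C, hC⟩ := hK.isBounded.exists_norm_le
    exact ⟨max C 1, by positivity, fun y hy => (hC y hy).trans (le_max_left _ _)⟩
  have hnz0 : 0 ≤ ‖z0‖ := norm_nonneg _
  set R : ℝ := 3 * (‖z0‖ + C0) + C0 with hR
  have hRpos : 0 < R := by positivity
  set L := Real.log (R - C0) with hL
  have hL1 : Real.log (‖z0‖ + C0) ≤ L - 1 := by
    have h1 : R - C0 = 3 * (‖z0‖ + C0) := by rw [hR]; ring
    have h2 : (1 : ℝ) ≤ Real.log 3 := by
      rw [Real.le_log_iff_exp_le (by norm_num)]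
      linarith [Real.exp_one_lt_d9]
    rw [hL, h1, Real.log_mul (by norm_num) (by positivity)]
    linarith
  have hz0R : z0 ∈ closedBall (0 : ℂ) R := by
    simp; linarith
  obtain ⟨B, hB⟩ : ∃ B : ℝ, ∀ z ∈ closedBall (0 : ℂ) R, u z ≤ (B : EReal) := by
    obtain ⟨zm, hzm, hm⟩ := (husc.mono (subset_univ _)).exists_isMaxOn ⟨z0, hz0R⟩
      (isCompact_closedBall (0 : ℂ) R)
    exact ⟨(u zm).toReal, fun z hz => (hm hz).trans (EReal.le_coe_toReal (hutop zm trivial))⟩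
  have haB : a ≤ B := by
    have := hB z0 hz0R
    rw [hua] at this
    exact_mod_cast this
  set ε : ℝ := 1 / (4 * (B - a + 1)) with hε
  have hBa : 0 < B - a + 1 := by linarith
  have hεpos : 0 < ε := by positivity
  have hεB : ε * (B - a) ≤ 1 / 4 := by
    have : ε * (B - a + 1) = 1 / 4 := by rw [hε]; field_simp
    nlinarith
  set η : ℝ := 1 / (4 * R ^ 2) with hη
  have hηpos : 0 < η := by positivity
  have hηR : η * R ^ 2 = 1 / 4 := by rw [hη]; field_simp
  set T : ℝ := max ((M + L - ε * a) / ε) (-a) with hT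
  have hT1 : M + L - ε * a ≤ ε * T := by
    have : (M + L - ε * a) / ε ≤ T := le_max_left _ _
    rw [div_le_iff₀ hεpos] at this
    linarith
  have hT2 : -T ≤ a := by linarith [le_max_right ((M + L - ε * a) / ε) (-a)]
  have hUopen : IsOpen {z | u z < ((-T : ℝ) : EReal)} := by
    have := (upperSemicontinuousOn_univ_iff.1 husc)
    exact this.isOpen_preimage _
  obtain ⟨δ, hδ, hδU⟩ := hK.exists_cthickening_subset_open hUopen (by
    intro z hz
    show u z < _
    rw [huK z hz]; exact EReal.bot_lt_coe _)
  refine ⟨δ, hδ, fun n x μ hx hμ hμ1 hp => ?_⟩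
  set p : ℂ → ℝ := fun z => ∑ i, μ i * Real.log ‖z - x i‖ with hpdef
  have hthick : ∀ z, z ∉ thickening δ K → ∀ i, z ≠ x i := by
    rintro z hz i rfl
    exact hz (self_subset_thickening hδ K (hx i))
  have hz0t : z0 ∉ thickening δ K := by
    intro h
    have : u z0 < ((-T : ℝ) : EReal) := hδU (thickening_subset_cthickening _ _ h)
    rw [hua] at this
    have : a < -T := by exact_mod_cast this
    linarith
  let G : ℂ → ℝ := fun z => (-p z + η * ‖z‖ ^ 2) / ε
  let A' : Set ℂ := closedBall (0 : ℂ) R \ thickening δ K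
  have hA'c : IsCompact A' := (isCompact_closedBall 0 R).diff isOpen_thickening
  have hpA : ContinuousOn p A' :=
    HarmonicOnNhd.continuousOn fun z hz => aux_pot_harm x μ z (hthick z hz.2)
  have hGc : ContinuousOn G A' := by
    simp only [G]; fun_prop
  have hΦ : UpperSemicontinuousOn (fun z => u z + (G z : EReal)) A' := by
    apply UpperSemicontinuousOn.add' (husc.mono (subset_univ _))
    · exact (continuous_coe_real_ereal.comp_continuousOn hGc).upperSemicontinuousOn
    · intro z hz
      apply EReal.continuousAt_add
      · exact Or.inr (EReal.coe_ne_bot _)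
      · exact Or.inr (EReal.coe_ne_top _)
  obtain ⟨zm, hzm, hmax⟩ := hΦ.exists_isMaxOn (show A'.Nonempty from ⟨z0, hz0R, hz0t⟩) hA'c
  have hm0 : (a : EReal) + (G z0 : EReal) ≤ u zm + (G zm : EReal) := by
    rw [← hua]; exact hmax ⟨hz0R, hz0t⟩
  have hzmbot : u zm ≠ ⊥ := by
    intro h
    rw [h, EReal.bot_add, ← EReal.coe_add] at hm0
    exact EReal.coe_ne_bot _ (le_bot_iff.1 hm0)
  set t := (u zm).toReal with ht
  have hut : u zm = (t : EReal) := (EReal.coe_toReal (hutop zm trivial) hzmbot).symm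
  have hm1 : ∀ z ∈ A', u z ≠ ⊥ → (u z).toReal + G z ≤ t + G zm := by
    intro z hz hb
    have h1 : u z + (G z : EReal) ≤ u zm + (G zm : EReal) := hmax hz
    rw [hut, ← EReal.coe_toReal (hutop z trivial) hb] at h1
    exact_mod_cast h1
  have hm2 := hm1 z0 ⟨hz0R, hz0t⟩ hz0
  rw [← ha] at hm2
  have hpz0 : p z0 ≤ L - 1 := by
    calc p z0 ≤ ∑ i, μ i * (L - 1) := by
          apply Finset.sum_le_sum
          intro i _
          refine mul_le_mul_of_nonneg_left ?_ (hμ i)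
          refine le_trans (Real.log_le_log (norm_pos_iff.2 (sub_ne_zero.2 (hthick z0 hz0t i))) ?_) hL1
          exact (norm_sub_le _ _).trans (by linarith [hC0 _ (hx i)])
      _ = L - 1 := by rw [← Finset.sum_mul, hμ1, one_mul]
  have hm3 : ε * a + (-p z0 + η * ‖z0‖ ^ 2) ≤ ε * t + (-p zm + η * ‖zm‖ ^ 2) := by
    have := mul_le_mul_of_nonneg_left hm2 hεpos.le
    simp only [G, mul_add] at this
    rw [mul_div_cancel₀ _ hεpos.ne', mul_div_cancel₀ _ hεpos.ne'] at this
    exact this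
  have hηz0 : 0 ≤ η * ‖z0‖ ^ 2 := by positivity
  have hzmR : ‖zm‖ ≤ R := by simpa using hzm.1
  have hηzm : η * ‖zm‖ ^ 2 ≤ 1 / 4 := by rw [← hηR]; gcongr
  have htB : t ≤ B := by
    have := hB zm hzm.1
    rw [hut] at this
    exact_mod_cast this
  -- case 1
  have hc1 : zm ∉ cthickening δ K := by
    intro h
    have h1 : u zm < ((-T : ℝ) : EReal) := hδU h
    rw [hut] at h1
    have h1 : t < -T := by exact_mod_cast h1
    have h2 := hp zm hzm.2
    have h3 : ε * t < ε * (-T) := mul_lt_mul_of_pos_left h1 hεpos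
    have h4 : -M ≤ p zm := h2
    linarith
  -- case 2
  have hc2 : ‖zm‖ < R := by
    refine lt_of_le_of_ne hzmR fun h => ?_
    have h1 : L ≤ p zm := by
      calc L = ∑ i, μ i * L := by rw [← Finset.sum_mul, hμ1, one_mul]
        _ ≤ p zm := by
          apply Finset.sum_le_sum
          intro i _
          refine mul_le_mul_of_nonneg_left ?_ (hμ i)
          refine Real.log_le_log (by rw [hR]; linarith) ?_
          have := norm_sub_norm_le zm (x i)
          have := hC0 _ (hx i)
          linarith
    have h3 : ε * t ≤ ε * B := mul_le_mul_of_nonneg_left htB hεpos.le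
    linarith
  -- case 3
  have hnhds : A' ∈ 𝓝 zm := by
    have h1 : ball (0 : ℂ) R ∩ (cthickening δ K)ᶜ ∈ 𝓝 zm :=
      (isOpen_ball.inter isClosed_cthickening.isOpen_compl).mem_nhds ⟨by simpa using hc2, hc1⟩
    refine mem_of_superset h1 ?_
    rintro z ⟨hz1, hz2⟩
    exact ⟨ball_subset_closedBall hz1, fun h => hz2 (thickening_subset_cthickening _ _ h)⟩
  obtain ⟨ρ, hρ, hρA⟩ := Metric.nhds_basis_closedBall.mem_iff.1 hnhds
  have hsm := hsub 0 1 zm ρ hρ (fun _ _ => trivial)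
  simp only [zero_add, smul_eq_mul, mul_one] at hsm
  rw [circleAvg] at hsm
  split_ifs at hsm with hcond
  swap
  · exact hzmbot (le_bot_iff.1 hsm)
  obtain ⟨hintg, hae⟩ := hcond
  rw [hut] at hsm
  have hsm : t ≤ (∫ θ in (0:ℝ)..(2 * Real.pi), (u (circleMap zm ρ θ)).toReal) / (2 * Real.pi) := by
    exact_mod_cast hsm
  let H : ℂ → ℝ := fun z => ε⁻¹ • (-p z + η • (‖z‖ ^ 2 - ‖z - zm‖ ^ 2))
  have hHh : HarmonicOnNhd H (closedBall zm |ρ|) := by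
    rw [abs_of_pos hρ]
    intro z hz
    apply HarmonicAt.const_smul
    apply HarmonicAt.add
    · exact HarmonicAt.neg (aux_pot_harm x μ z (hthick z (hρA hz).2))
    · apply HarmonicAt.const_smul
      exact aux_sq zm z
  have hHav := hHh.circleAverage_eq
  have hHci : CircleIntegrable H zm ρ := by
    apply ContinuousOn.circleIntegrable'
    exact hHh.continuousOn.mono sphere_subset_closedBall
  have hHm : H zm = G zm := by simp [H, G]; ring
  have hle : (∫ θ in (0:ℝ)..(2 * Real.pi), (u (circleMap zm ρ θ)).toReal) ≤
      ∫ θ in (0:ℝ)..(2 * Real.pi), ((t + H zm - η * ρ ^ 2 / ε) - H (circleMap zm ρ θ)) := by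
    apply intervalIntegral.integral_mono_ae_restrict Real.two_pi_pos.le hintg
    · exact intervalIntegrable_const.sub hHci
    · rw [restrict_Ioc_eq_restrict_Icc] at hae
      filter_upwards [hae] with θ hθ
      have hmem := circleMap_mem_closedBall zm hρ.le θ
      have h1 := hm1 _ (hρA hmem) hθ
      have h2 : ‖circleMap zm ρ θ - zm‖ = ρ := by simp [circleMap, abs_of_pos hρ]
      have h3 : G (circleMap zm ρ θ) = H (circleMap zm ρ θ) + η * ρ ^ 2 / ε := by
        simp only [G, H, h2, smul_eq_mul]; field_simp; ring
      rw [hHm]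
      linarith
  rw [intervalIntegral.integral_sub intervalIntegrable_const hHci] at hle
  rw [Real.circleAverage_def, smul_eq_mul, inv_mul_eq_div, div_eq_iff (by positivity)] at hHav
  rw [hHav, intervalIntegral.integral_const, sub_zero, smul_eq_mul] at hle
  rw [le_div_iff₀ (by positivity)] at hsm
  have h9 : 0 < η * ρ ^ 2 / ε := by positivity
  have h10 := Real.two_pi_pos
  nlinarith [mul_pos h9 h10]

lemma aux_cap {K : Set ℂ} (hK : IsCompact K) (hKp : PolarSet K) (M : ℝ) :
    ∃ (n : ℕ) (x : Fin n → ℂ) (μ : Fin n → ℝ) (δ : ℝ), 0 < δ ∧ (∀ i, x i ∈ K) ∧ (∀ i, 0 ≤ μ i) ∧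
      ∑ i, μ i ≤ 1 ∧ ∀ z ∈ thickening δ K, z ∉ K → ∑ i, μ i * Real.log ‖z - x i‖ ≤ -M := by
  rcases K.eq_empty_or_nonempty with rfl | hKne
  · exact ⟨0, Fin.elim0, Fin.elim0, 1, one_pos, fun i => i.elim0, fun i => i.elim0, by simp,
      by simp⟩
  obtain ⟨u, hu, huK⟩ := hKp
  obtain ⟨δ, hδ, hpol⟩ := aux_polar hu hK huK (M + Real.log 3 + Real.log 2)
  obtain ⟨t, htK, htf, htcov⟩ := hK.finite_cover_balls hδ
  obtain ⟨n, x, -, hxt⟩ := htf.fin_param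
  have hx : ∀ i, x i ∈ K := fun i => htK (hxt ▸ mem_range_self i)
  have hnet : ∀ y ∈ K, ∃ i, ‖y - x i‖ < δ := by
    intro y hy
    have := htcov hy
    simp only [mem_iUnion] at this
    obtain ⟨c, hc, hyc⟩ := this
    rw [← hxt] at hc
    obtain ⟨i, rfl⟩ := hc
    exact ⟨i, by simpa [dist_eq_norm] using hyc⟩
  have hn : 0 < n := by
    obtain ⟨y, hy⟩ := hKne
    obtain ⟨i, -⟩ := hnet y hy
    exact i.pos
  let m : Fin n → Fin n → ℝ := fun i j => max δ ‖x i - x j‖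
  have hmpos : ∀ i j, 0 < m i j := fun i j => lt_of_lt_of_le hδ (le_max_left _ _)
  obtain ⟨μ, V, hμ0, hμ1, hV1, hV2⟩ := aux_energy hn (fun i j => Real.log (m i j))
    (fun i j => by simp only [m, norm_sub_rev])
  have hVM : V ≤ -(M + Real.log 3) := by
    by_contra hcon
    push Not at hcon
    refine hpol n x μ hx hμ0 hμ1 fun z hz => ?_
    have hzd : ∀ y ∈ K, δ ≤ ‖z - y‖ := by
      intro y hy
      by_contra h
      push Not at h
      exact hz (mem_thickening_iff.2 ⟨y, hy, by rwa [dist_eq_norm]⟩)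
    -- nearest point of the support
    have hsupp : (Finset.univ.filter fun i => μ i ≠ 0).Nonempty := by
      by_contra h
      rw [Finset.not_nonempty_iff_eq_empty, Finset.filter_eq_empty_iff] at h
      have : ∑ i, μ i = 0 := Finset.sum_eq_zero fun i hi => by simpa using h hi
      linarith
    obtain ⟨i0, hi0, hmin⟩ := Finset.exists_min_image _ (fun i => ‖z - x i‖) hsupp
    have hi0' : μ i0 ≠ 0 := by simpa using hi0
    have h1 := hV2 i0 hi0'
    have h2 : V - Real.log 2 ≤ ∑ i, μ i * Real.log ‖z - x i‖ := by
      calc V - Real.log 2 = ∑ i, μ i * (Real.log (m i0 i) - Real.log 2) := by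
            simp only [mul_sub, Finset.sum_sub_distrib, h1, ← Finset.sum_mul, hμ1, one_mul]
        _ ≤ _ := by
            apply Finset.sum_le_sum
            intro i _
            by_cases hi : μ i = 0
            · simp [hi]
            refine mul_le_mul_of_nonneg_left ?_ (hμ0 i)
            have hpos : 0 < ‖z - x i‖ := lt_of_lt_of_le hδ (hzd _ (hx i))
            rw [sub_le_iff_le_add, ← Real.log_mul hpos.ne' (by norm_num)]
            apply Real.log_le_log (hmpos _ _)
            apply max_le
            · linarith [hzd _ (hx i)]
            · have h3 := hmin i (by simpa using hi)
              have h4 : ‖x i0 - x i‖ ≤ ‖z - x i0‖ + ‖z - x i‖ := by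
                have := norm_sub_le (z - x i) (z - x i0)
                have e : (z - x i) - (z - x i0) = x i0 - x i := by ring
                rw [e] at this; linarith
              linarith
    linarith
  refine ⟨n, x, μ, δ, hδ, hx, hμ0, hμ1.le, fun z hz hzK => ?_⟩
  obtain ⟨y, hy, hzy⟩ := mem_thickening_iff.1 hz
  rw [dist_eq_norm] at hzy
  obtain ⟨i0, hi0⟩ := hnet y hy
  calc ∑ i, μ i * Real.log ‖z - x i‖ ≤ ∑ i, μ i * (Real.log (m i0 i) + Real.log 3) := by
        apply Finset.sum_le_sum
        intro i _
        refine mul_le_mul_of_nonneg_left ?_ (hμ0 i)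
        have hne : z - x i ≠ 0 := sub_ne_zero.2 (by rintro rfl; exact hzK (hx i))
        rw [← Real.log_mul (hmpos _ _).ne' (by norm_num)]
        apply Real.log_le_log (norm_pos_iff.2 hne)
        have h1 : ‖z - x i‖ ≤ ‖z - y‖ + ‖y - x i0‖ + ‖x i0 - x i‖ := by
          have e : z - x i = (z - y) + (y - x i0) + (x i0 - x i) := by ring
          rw [e]; exact norm_add₃_le
        have h2 : δ ≤ m i0 i := le_max_left _ _
        have h3 : ‖x i0 - x i‖ ≤ m i0 i := le_max_right _ _
        linarith
    _ = (∑ i, μ i * Real.log (m i0 i)) + Real.log 3 := by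
        simp only [mul_add, Finset.sum_add_distrib, ← Finset.sum_mul, hμ1, one_mul]
    _ ≤ -M := by linarith [hV1 i0]

/-- The function `log⁺`. -/
noncomputable def lpx (x : ℝ) : ℝ := Real.log (max 1 x)

lemma lpx_nonneg (x : ℝ) : 0 ≤ lpx x := Real.log_nonneg (le_max_left _ _)

lemma lpx_cont : Continuous lpx := by
  unfold lpx
  refine Continuous.log (by fun_prop) (fun x => ?_)
  have : (1 : ℝ) ≤ max 1 x := le_max_left _ _
  linarith

lemma log_le_lpx {x : ℝ} (hx : 0 ≤ x) : Real.log x ≤ lpx x := by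
  rcases hx.eq_or_lt with rfl | h
  · simpa using lpx_nonneg 0
  · exact Real.log_le_log h (le_max_right _ _)

lemma lpx_mono {x y : ℝ} (h : x ≤ y) : lpx x ≤ lpx y :=
  Real.log_le_log (lt_of_lt_of_le one_pos (le_max_left _ _)) (max_le_max le_rfl h)

open InnerProductSpace in
lemma aux_pot_harm' {n : ℕ} (x : Fin n → ℂ) (μ : Fin n → ℝ) (z : ℂ) {g : ℂ → ℂ}
    (hg : AnalyticAt ℂ g z) (hz : ∀ i, g z ≠ x i) :
    HarmonicAt (fun z => ∑ i, μ i * Real.log ‖g z - x i‖) z := by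
  suffices H : ∀ s : Finset (Fin n), HarmonicAt (fun z => ∑ i ∈ s, μ i * Real.log ‖g z - x i‖) z from H _
  intro s
  induction s using Finset.induction_on with
  | empty => simp
  | insert a s ha ih =>
    simp only [Finset.sum_insert ha]
    refine HarmonicAt.add (HarmonicAt.const_smul (c := μ a) ?_) ih
    exact AnalyticAt.harmonicAt_log_norm (by fun_prop) (sub_ne_zero.2 (hz a))

open InnerProductSpace in
lemma aux_lpx_supp {g : ℂ → ℂ} {z : ℂ} (hg : AnalyticAt ℂ g z) :
    ∃ ψ : ℂ → ℝ, HarmonicAt ψ z ∧ ψ z = lpx ‖g z‖ ∧ ∀ y, ψ y ≤ lpx ‖g y‖ := by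
  by_cases h : ‖g z‖ ≤ 1
  · refine ⟨fun _ => 0, by simp, ?_, fun y => lpx_nonneg _⟩
    simp [lpx, max_eq_left h]
  · push Not at h
    refine ⟨fun y => Real.log ‖g y‖, ?_, ?_, fun y => log_le_lpx (norm_nonneg _)⟩
    · apply AnalyticAt.harmonicAt_log_norm hg
      rw [← norm_pos_iff]; linarith
    · simp [lpx, max_eq_right h.le]

open InnerProductSpace in
lemma aux_stage {D K : Set ℂ} {f : ℂ → ℂ} (hD : IsOpen D) (hKcpt : IsCompact K)
    (hKp : PolarSet K) (hf : DifferentiableOn ℂ f (D \ K))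
    {b C0 : ℝ} (hb : 0 < b) (hbD : cthickening b K ⊆ D) (hC0 : ∀ y ∈ K, ‖y‖ ≤ C0)
    {M r0 : ℝ} (hM : 0 ≤ M) (hr0 : 0 < r0) :
    ∃ g : ℂ × ℂ → ℝ, ContinuousOn g (D ×ˢ (Set.univ : Set ℂ)) ∧
      (∀ a b : ℂ × ℂ, ∀ c : ℂ, ∀ r : ℝ, 0 < r →
        (∀ l ∈ Metric.closedBall c r, a + l • b ∈ D ×ˢ (Set.univ : Set ℂ)) →
        g (a + c • b) ≤ Real.circleAverage (fun l : ℂ => g (a + l • b)) c r) ∧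
      (∀ z ∈ cthickening b K, ∀ w, g (z, w) ≤ lpx ‖w‖ + lpx (‖z‖ + C0) + 1) ∧
      (∀ z ∈ D \ K, ∀ w, g (z, w) ≤ lpx ‖w‖ + lpx ‖w - f z‖ + lpx (‖z‖ + C0) + 1) ∧
      (∀ z ∈ K, ∀ w, g (z, w) ≤ -(M - 1) + lpx ‖w‖) ∧
      (∀ z ∈ D, z ∉ thickening r0 K → g (z, f z) ≤ -(M - 1) + lpx ‖f z‖) ∧
      (∀ d > 0, ∀ z ∈ D, z ∉ thickening r0 K → z ∉ thickening d K → ∀ w, w ≠ f z →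
        -|Real.log ‖w - f z‖| - |Real.log d| ≤ g (z, w)) := by
  classical
  obtain ⟨n, x, μ, δ, hδ, hx, hμ0, hμ1, hp⟩ := aux_cap hKcpt hKp M
  set p : ℂ → ℝ := fun z => ∑ i, μ i * Real.log ‖z - x i‖ with hpdef
  obtain ⟨r, hr, hrb, hrδ, hrr0⟩ : ∃ r : ℝ, 0 < r ∧ 2 * r ≤ b ∧ 2 * r ≤ δ ∧ r ≤ r0 := by
    refine ⟨min (b / 2) (min (δ / 2) r0), by positivity, ?_, ?_, ?_⟩
    · linarith [min_le_left (b / 2) (min (δ / 2) r0)]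
    · linarith [min_le_right (b / 2) (min (δ / 2) r0), min_le_left (δ / 2) r0]
    · linarith [min_le_right (b / 2) (min (δ / 2) r0), min_le_right (δ / 2) r0]
  set V := thickening r K with hV
  set V' := thickening (2 * r) K with hV'
  have hVo : IsOpen V := isOpen_thickening
  have hV'o : IsOpen V' := isOpen_thickening
  have hKV : K ⊆ V := self_subset_thickening hr K
  have hVV' : closure V ⊆ V' :=
    (closure_thickening_subset_cthickening r K).trans (cthickening_subset_thickening' (by linarith) (by linarith) K)
  have hV'b : V' ⊆ cthickening b K :=
    (thickening_mono hrb K).trans (thickening_subset_cthickening b K)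
  have hDK : IsOpen (D \ K) := hD.sdiff hKcpt.isClosed
  have hfan : ∀ z ∈ D \ K, AnalyticAt ℂ f z := fun z hz => hf.analyticAt (hDK.mem_nhds hz)
  obtain ⟨C1, hC1, hfC1⟩ : ∃ C1 : ℝ, 0 ≤ C1 ∧ ∀ z ∈ cthickening b K \ V, ‖f z‖ ≤ C1 := by
    have hc : IsCompact (cthickening b K \ V) := hKcpt.cthickening.diff hVo
    have hfc : ContinuousOn f (cthickening b K \ V) :=
      hf.continuousOn.mono fun z hz => ⟨hbD hz.1, fun h => hz.2 (hKV h)⟩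
    obtain ⟨C, hC⟩ := hc.exists_bound_of_continuousOn hfc
    exact ⟨max C 0, le_max_right _ _, fun z hz => (hC z hz).trans (le_max_left _ _)⟩
  have hlog1 : 0 ≤ Real.log (1 + C1) := Real.log_nonneg (by linarith)
  set τ : ℝ := 1 / (1 + Real.log (1 + C1)) with hτ
  have hτ0 : 0 < τ := by positivity
  have hτ1 : τ ≤ 1 := by rw [hτ, div_le_one (by positivity)]; linarith
  have hτC : τ * Real.log (1 + C1) ≤ 1 := by
    rw [hτ, one_div, inv_mul_eq_div, div_le_one (by positivity)]; linarith
  have hτlp : ∀ y, τ * lpx y ≤ lpx y := fun y => by nlinarith [lpx_nonneg y]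
  set s : ℂ → ℝ := fun w => -(M - 1) + τ * lpx ‖w‖ with hs
  have hsc : Continuous s := by
    have := lpx_cont
    simp only [hs]; fun_prop
  -- estimate of the logarithm near `K`
  have hest : ∀ z ∈ cthickening b K \ V, ∀ w, τ * Real.log ‖w - f z‖ ≤ τ * lpx ‖w‖ + 1 := by
    intro z hz w
    have h1 : Real.log ‖w - f z‖ ≤ lpx ‖w‖ + Real.log (1 + C1) := by
      have hm : (1 : ℝ) ≤ max 1 ‖w‖ := le_max_left _ _
      rcases (norm_nonneg (w - f z)).eq_or_lt with h | h
      · rw [← h, Real.log_zero]; linarith [lpx_nonneg ‖w‖]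
      · rw [lpx, ← Real.log_mul (by linarith) (by linarith)]
        apply Real.log_le_log h
        have := norm_sub_le w (f z)
        have h3 := hfC1 z hz
        have h4 : ‖w‖ ≤ max 1 ‖w‖ := le_max_right _ _
        nlinarith
    have := mul_le_mul_of_nonneg_left h1 hτ0.le
    rw [mul_add] at this
    linarith
  set q : ℂ × ℂ → ℝ := fun P =>
    τ * Real.log (max ‖P.2 - f P.1‖ (Real.exp ((s P.2 - p P.1) / τ))) + p P.1 with hq
  have hqs : ∀ z w, ‖w - f z‖ ≤ Real.exp ((s w - p z) / τ) → q (z, w) = s w := by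
    intro z w h
    simp only [hq, max_eq_right h, Real.log_exp]
    field_simp; ring
  have hqg : ∀ z w, Real.exp ((s w - p z) / τ) < ‖w - f z‖ →
      q (z, w) = τ * Real.log ‖w - f z‖ + p z := by
    intro z w h
    simp only [hq, max_eq_left h.le]
  have hsq : ∀ z w, s w ≤ q (z, w) := by
    intro z w
    have h1 : (s w - p z) / τ ≤ Real.log (max ‖w - f z‖ (Real.exp ((s w - p z) / τ))) := by
      rw [Real.le_log_iff_exp_le (lt_of_lt_of_le (Real.exp_pos _) (le_max_right _ _))]
      exact le_max_right _ _
    rw [div_le_iff₀ hτ0] at h1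
    simp only [hq]; linarith
  have hlq : ∀ z w, w ≠ f z → τ * Real.log ‖w - f z‖ + p z ≤ q (z, w) := by
    intro z w h
    have h1 : 0 < ‖w - f z‖ := norm_pos_iff.2 (sub_ne_zero.2 h)
    have h2 := Real.log_le_log h1 (le_max_left ‖w - f z‖ (Real.exp ((s w - p z) / τ)))
    have := mul_le_mul_of_nonneg_left h2 hτ0.le
    simp only [hq]; linarith
  have hqV' : ∀ z ∈ V', z ∉ V → ∀ w, q (z, w) = s w := by
    intro z hz hzV w
    apply hqs
    rcases (norm_nonneg (w - f z)).eq_or_lt with h | h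
    · rw [← h]; exact (Real.exp_pos _).le
    · rw [← Real.log_le_iff_le_exp h, le_div_iff₀ hτ0]
      have h1 := hest z ⟨hV'b hz, hzV⟩ w
      have h2 : p z ≤ -M := hp z (thickening_mono hrδ K hz) (fun h => hzV (hKV h))
      simp only [hs]; linarith
  set g : ℂ × ℂ → ℝ := fun P => if P.1 ∈ V then s P.2 else q P with hg
  have hgV' : ∀ z ∈ V', ∀ w, g (z, w) = s w := by
    intro z hz w
    by_cases hzV : z ∈ V
    · simp [hg, hzV]
    · simp only [hg, hzV, if_false]; exact hqV' z hz hzV w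
  have hgV : ∀ z, z ∉ V → ∀ w, g (z, w) = q (z, w) := by
    intro z hz w
    simp [hg, hz]
  have hsg : ∀ z w, s w ≤ g (z, w) := by
    intro z w
    by_cases hzV : z ∈ V
    · simp [hg, hzV]
    · rw [hgV z hzV]; exact hsq z w
  have hpc : ∀ z, z ∉ K → ContinuousAt p z := fun z hz =>
    (aux_pot_harm x μ z (by rintro i rfl; exact hz (hx i))).1.continuousAt
  have hpup : ∀ z, z ∉ K → p z ≤ lpx (‖z‖ + C0) := by
    intro z hz
    calc p z ≤ ∑ i, μ i * lpx (‖z‖ + C0) := by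
          apply Finset.sum_le_sum
          intro i _
          refine mul_le_mul_of_nonneg_left ((log_le_lpx (norm_nonneg _)).trans (lpx_mono ?_)) (hμ0 i)
          exact (norm_sub_le _ _).trans (by linarith [hC0 _ (hx i)])
      _ = (∑ i, μ i) * lpx (‖z‖ + C0) := by rw [Finset.sum_mul]
      _ ≤ lpx (‖z‖ + C0) := by nlinarith [lpx_nonneg (‖z‖ + C0)]
  have hVc : ∀ z, z ∉ V' → Vᶜ ∈ 𝓝 z := by
    intro z hz
    exact mem_of_superset (isClosed_closure.isOpen_compl.mem_nhds fun h => hz (hVV' h))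
      (compl_subset_compl.2 subset_closure)
  have hgc : ContinuousOn g (D ×ˢ (Set.univ : Set ℂ)) := by
    rintro ⟨z, w⟩ ⟨hzD, -⟩
    apply ContinuousAt.continuousWithinAt
    by_cases hzV : z ∈ V'
    · have : g =ᶠ[𝓝 (z, w)] fun P => s P.2 := by
        filter_upwards [continuousAt_fst.preimage_mem_nhds (hV'o.mem_nhds hzV)] with P hP
        exact hgV' P.1 hP P.2
      rw [continuousAt_congr this]
      exact (hsc.comp continuous_snd).continuousAt
    · have hzK : z ∉ K := fun h => hzV (hVV' (subset_closure (hKV h)))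
      have : g =ᶠ[𝓝 (z, w)] q := by
        filter_upwards [continuousAt_fst.preimage_mem_nhds (hVc z hzV)] with P hP
        exact hgV P.1 hP P.2
      rw [continuousAt_congr this]
      have h1 : ContinuousAt (fun P : ℂ × ℂ => f P.1) (z, w) :=
        ContinuousAt.comp (f := Prod.fst) (g := f) (hfan z ⟨hzD, hzK⟩).continuousAt continuousAt_fst
      have h2 : ContinuousAt (fun P : ℂ × ℂ => p P.1) (z, w) :=
        ContinuousAt.comp (f := Prod.fst) (g := p) (hpc z hzK) continuousAt_fst
      have h3 : ContinuousAt (fun P : ℂ × ℂ => s P.2) (z, w) := (hsc.comp continuous_snd).continuousAt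
      refine ContinuousAt.add (ContinuousAt.mul continuousAt_const (ContinuousAt.log ?_ ?_)) h2
      · refine Filter.Tendsto.max (continuousAt_snd.sub h1).norm ?_
        exact Real.continuous_exp.continuousAt.comp ((h3.sub h2).div_const τ)
      · exact (lt_of_lt_of_le (Real.exp_pos _) (le_max_right _ _)).ne'
  have hbasic : ∀ z ∈ D \ K, z ∉ V → ∀ w B, τ * Real.log ‖w - f z‖ ≤ B → 0 ≤ B →
      g (z, w) ≤ lpx ‖w‖ + B + lpx (‖z‖ + C0) + 1 := by
    intro z hz hzV w B hB hB0
    rw [hgV z hzV]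
    rcases le_or_gt ‖w - f z‖ (Real.exp ((s w - p z) / τ)) with h | h
    · rw [hqs z w h]
      have := hτlp ‖w‖
      have := lpx_nonneg (‖z‖ + C0)
      simp only [hs]; linarith
    · rw [hqg z w h]
      have := hpup z hz.2
      have := lpx_nonneg ‖w‖
      linarith
  refine ⟨g, hgc, ?_, ?_, ?_, ?_, ?_, ?_⟩
  · intro a b c ρ hρ hΩ
    apply aux_loc_glob (φ := fun l : ℂ => g (a + l • b)) hρ
    · exact hgc.comp (by fun_prop) hΩ
    · intro l hl
      have hlD : a.1 + l * b.1 ∈ D := by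
        have := (hΩ l (ball_subset_closedBall hl)).1
        simpa using this
      have hpt : ∀ y : ℂ, a + y • b = (a.1 + y * b.1, a.2 + y * b.2) := fun y => by
        ext <;> simp
      simp only [hpt]
      have hw : AnalyticAt ℂ (fun y : ℂ => a.2 + y * b.2) l := by fun_prop
      have hz : AnalyticAt ℂ (fun y : ℂ => a.1 + y * b.1) l := by fun_prop
      by_cases hgs : g (a.1 + l * b.1, a.2 + l * b.2) = s (a.2 + l * b.2)
      · obtain ⟨ψ, hψ, hψe, hψle⟩ := aux_lpx_supp hw
        refine ⟨fun y => -(M - 1) + τ * ψ y, ?_, ?_, ?_⟩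
        · exact (harmonicAt_const _).add (hψ.const_smul (c := τ))
        · rw [hgs]; simp only [hs, hψe]
        · refine Eventually.of_forall fun y => le_trans ?_ (hsg _ _)
          have := mul_le_mul_of_nonneg_left (hψle y) hτ0.le
          simp only [hs]; linarith
      · have hzV' : a.1 + l * b.1 ∉ V' := fun h => hgs (hgV' _ h _)
        have hzV : a.1 + l * b.1 ∉ V := fun h => hzV' (hVV' (subset_closure h))
        have hzK : a.1 + l * b.1 ∉ K := fun h => hzV (hKV h)
        have hlt : Real.exp ((s (a.2 + l * b.2) - p (a.1 + l * b.1)) / τ) <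
            ‖(a.2 + l * b.2) - f (a.1 + l * b.1)‖ := by
          by_contra h
          push Not at h
          exact hgs (by rw [hgV _ hzV]; exact hqs _ _ h)
        have hfz : AnalyticAt ℂ (fun y : ℂ => (a.2 + y * b.2) - f (a.1 + y * b.1)) l := by
          apply hw.sub
          exact AnalyticAt.fun_comp (hfan _ ⟨hlD, hzK⟩) hz
        have hne : (a.2 + l * b.2) - f (a.1 + l * b.1) ≠ 0 := by
          rw [← norm_pos_iff]; exact (Real.exp_pos _).trans hlt
        refine ⟨fun y => τ * Real.log ‖(a.2 + y * b.2) - f (a.1 + y * b.1)‖ + p (a.1 + y * b.1),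
          ?_, ?_, ?_⟩
        · refine HarmonicAt.add (HarmonicAt.const_smul (c := τ) (hfz.harmonicAt_log_norm hne)) ?_
          refine aux_pot_harm' x μ l hz ?_
          intro i h
          exact hzK (h ▸ hx i)
        · rw [hgV _ hzV, hqg _ _ hlt]
        · have e1 := hz.continuousAt.preimage_mem_nhds (hVc _ hzV')
          have e2 := hfz.continuousAt.eventually_ne hne
          filter_upwards [e1, e2] with y hy1 hy2
          rw [hgV _ hy1]
          exact hlq _ _ (sub_ne_zero.1 hy2)
  · intro z hz w
    by_cases hzV : z ∈ V
    · rw [hgV' z (hVV' (subset_closure hzV))]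
      have := hτlp ‖w‖
      have := lpx_nonneg (‖z‖ + C0)
      simp only [hs]; linarith
    · have h1 := hest z ⟨hz, hzV⟩ w
      rw [hgV z hzV]
      rcases le_or_gt ‖w - f z‖ (Real.exp ((s w - p z) / τ)) with h | h
      · rw [hqs z w h]
        have := hτlp ‖w‖
        have := lpx_nonneg (‖z‖ + C0)
        simp only [hs]; linarith
      · rw [hqg z w h]
        have := hpup z (fun h => hzV (hKV h))
        have := hτlp ‖w‖
        linarith
  · intro z hz w
    by_cases hzV : z ∈ V
    · rw [hgV' z (hVV' (subset_closure hzV))]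
      have := hτlp ‖w‖
      have := lpx_nonneg (‖z‖ + C0)
      have := lpx_nonneg ‖w - f z‖
      simp only [hs]; linarith
    · refine hbasic z hz hzV w _ ?_ (lpx_nonneg _)
      have := mul_le_mul_of_nonneg_left (log_le_lpx (norm_nonneg (w - f z))) hτ0.le
      linarith [hτlp ‖w - f z‖]
  · intro z hz w
    rw [hgV' z (hVV' (subset_closure (hKV hz)))]
    have := hτlp ‖w‖
    simp only [hs]; linarith
  · intro z hz hzr
    rw [hgV z (fun h => hzr (thickening_mono hrr0 K h)), hqs]
    · have := hτlp ‖f z‖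
      simp only [hs]; linarith
    · simp; exact (Real.exp_pos _).le
  · intro d hd z hz hzr hzd w hw
    rw [hgV z (fun h => hzr (thickening_mono hrr0 K h))]
    refine le_trans ?_ (hlq z w hw)
    have h1 : -|Real.log ‖w - f z‖| ≤ τ * Real.log ‖w - f z‖ := by
      have := neg_abs_le (Real.log ‖w - f z‖)
      have := abs_nonneg (Real.log ‖w - f z‖)
      nlinarith
    have h2 : -|Real.log d| ≤ p z := by
      calc -|Real.log d| ≤ (∑ i, μ i) * (-|Real.log d|) := by
            nlinarith [abs_nonneg (Real.log d)]
        _ = ∑ i, μ i * (-|Real.log d|) := by rw [Finset.sum_mul]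
        _ ≤ p z := by
          apply Finset.sum_le_sum
          intro i _
          refine mul_le_mul_of_nonneg_left ?_ (hμ0 i)
          refine (neg_abs_le _).trans (Real.log_le_log hd ?_)
          by_contra h
          push Not at h
          exact hzd (mem_thickening_iff.2 ⟨x i, hx i, by rwa [dist_eq_norm]⟩)
    linarith

lemma aux_notsum {a : ℕ → ℝ} {C : ℝ} (h : ∀ᶠ k in atTop, a k ≤ -2^k + C) :
    ¬ Summable (fun k => (1/2:ℝ)^k * a k) := by
  intro hs
  have h0 := hs.tendsto_atTop_zero
  have h1 : Tendsto (fun k : ℕ => -1 + (1/2:ℝ)^k * C) atTop (𝓝 (-1 + 0 * C)) := by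
    apply Tendsto.const_add
    apply Tendsto.mul_const
    exact tendsto_pow_atTop_nhds_zero_of_lt_one (by norm_num) (by norm_num)
  have := le_of_tendsto_of_tendsto h0 h1 (by
    filter_upwards [h] with k hk
    have h2 : (0:ℝ) < (1/2)^k := by positivity
    have h3 : (1/2:ℝ)^k * 2^k = 1 := by rw [← mul_pow]; norm_num
    nlinarith)
  norm_num at this

lemma aux_sum {a : ℕ → ℝ} {C C' : ℝ} {k0 : ℕ} (h : ∀ k, a k ≤ C) (h' : ∀ k ≥ k0, -C' ≤ a k) :
    Summable (fun k => (1/2:ℝ)^k * a k) := by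
  refine Summable.of_norm_bounded_eventually_nat (g := fun k => (1/2:ℝ)^k * (|C| + |C'|))
    (summable_geometric_two.mul_right _) ?_
  filter_upwards [eventually_ge_atTop k0] with k hk
  rw [norm_mul, Real.norm_of_nonneg (by positivity)]
  gcongr
  rw [Real.norm_eq_abs, abs_le]
  have := h k
  have := h' k hk
  have := le_abs_self C
  have := le_abs_self C'
  have := abs_nonneg C
  have := abs_nonneg C'
  constructor <;> linarith

open Classical in
noncomputable def uS (E : Set (ℂ × ℂ)) (g : ℕ → ℂ × ℂ → ℝ) (p : ℂ × ℂ) : EReal :=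
  if p ∈ E then ⊥ else ((∑' k, (1/2:ℝ)^k * g k p : ℝ) : EReal)

lemma aux_tail {a : ℕ → ℝ} {C : ℝ} (hs : Summable (fun k => (1/2:ℝ)^k * a k)) :
    Summable (fun k => (1/2:ℝ)^k * (C - a k)) ∧
    ∑' k, (1/2:ℝ)^k * a k = 2 * C - ∑' k, (1/2:ℝ)^k * (C - a k) := by
  have h1 : Summable (fun k => (1/2:ℝ)^k * C) := summable_geometric_two.mul_right _
  have e : (fun k => (1/2:ℝ)^k * (C - a k)) = fun k => (1/2:ℝ)^k * C - (1/2:ℝ)^k * a k := by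
    ext k; ring
  have h2 : Summable (fun k => (1/2:ℝ)^k * (C - a k)) := by
    rw [e]; exact h1.sub hs
  refine ⟨h2, ?_⟩
  rw [e, h1.tsum_sub hs, tsum_mul_right, tsum_geometric_two]
  ring

lemma aux_tail' {a : ℕ → ℝ} {C : ℝ} (hs : Summable (fun k => (1/2:ℝ)^k * (C - a k))) :
    Summable (fun k => (1/2:ℝ)^k * a k) := by
  have h1 : Summable (fun k => (1/2:ℝ)^k * C) := summable_geometric_two.mul_right _
  have e : (fun k => (1/2:ℝ)^k * a k) = fun k => (1/2:ℝ)^k * C - (1/2:ℝ)^k * (C - a k) := by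
    ext k; ring
  rw [e]; exact h1.sub hs

lemma aux_uS_cont {Ω E : Set (ℂ × ℂ)} (hΩ : IsOpen Ω) {g : ℕ → ℂ × ℂ → ℝ}
    (hg : ∀ k, ContinuousOn (g k) Ω)
    (hup : ∀ p ∈ Ω, ∃ C, ∀ᶠ q in 𝓝 p, ∀ k, g k q ≤ C)
    (hE : ∀ p ∈ Ω, p ∈ E → ∃ C, ∀ᶠ k in atTop, g k p ≤ -2^k + C)
    (hnE : ∀ p ∈ Ω, p ∉ E → ∃ C, ∃ k0, ∀ᶠ q in 𝓝 p, ∀ k ≥ k0, -C ≤ g k q) :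
    ContinuousOn (uS E g) Ω := by
  intro p hp
  apply ContinuousAt.continuousWithinAt
  have hgp : ∀ k, ContinuousAt (g k) p := fun k => (hg k).continuousAt (hΩ.mem_nhds hp)
  obtain ⟨C, hC⟩ := hup p hp
  by_cases hpE : p ∈ E
  · have hup : uS E g p = ⊥ := by simp [uS, hpE]
    rw [ContinuousAt, hup, EReal.tendsto_nhds_bot_iff_real]
    intro y
    obtain ⟨C1, hC1⟩ := hE p hp hpE
    have hns : ¬ Summable (fun k => (1/2:ℝ)^k * (C - g k p)) := fun h =>
      aux_notsum hC1 (aux_tail' h)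
    have hCp := hC.self_of_nhds
    rw [not_summable_iff_tendsto_nat_atTop_of_nonneg
      (fun k => mul_nonneg (by positivity) (sub_nonneg.2 (hCp k)))] at hns
    obtain ⟨n, hn⟩ := (hns.eventually_gt_atTop (2 * C - y)).exists
    have hT : ContinuousAt (fun q => ∑ k ∈ Finset.range n, (1/2:ℝ)^k * (C - g k q)) p := by
      apply tendsto_finsetSum
      intro k _
      exact (continuousAt_const.sub (hgp k)).const_mul _ 
    filter_upwards [hC, hT.eventually (lt_mem_nhds hn), hΩ.mem_nhds hp] with q hq hq2 hqΩ
    by_cases hqE : q ∈ E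
    · simp [uS, hqE, EReal.bot_lt_coe]
    · simp only [uS, hqE, if_false, EReal.coe_lt_coe_iff]
      obtain ⟨C2, k0, h2⟩ := hnE q hqΩ hqE
      have hs := aux_sum hq h2.self_of_nhds
      obtain ⟨h3, h4⟩ := aux_tail (C := C) hs
      rw [h4]
      have := h3.sum_le_tsum (Finset.range n)
        (fun k _ => mul_nonneg (by positivity) (sub_nonneg.2 (hq k)))
      linarith
  · obtain ⟨C2, k0, h2⟩ := hnE p hp hpE
    have hfin : ∀ᶠ q in 𝓝 p, ∀ k ∈ Finset.range k0, |g k q| < |g k p| + 1 := by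
      rw [Filter.eventually_all_finset]
      intro k _
      exact (hgp k).abs.eventually (gt_mem_nhds (by linarith))
    set B := |C| + |C2| + ∑ k ∈ Finset.range k0, (|g k p| + 1) with hB
    have hsum0 : ∀ k ∈ Finset.range k0, |g k p| + 1 ≤ ∑ k ∈ Finset.range k0, (|g k p| + 1) :=
      fun k hk => Finset.single_le_sum (f := fun k => |g k p| + 1) (fun i _ => by positivity) hk
    have hsum1 : 0 ≤ ∑ k ∈ Finset.range k0, (|g k p| + 1) :=
      Finset.sum_nonneg (fun i _ => by positivity)
    have hall : ∀ᶠ q in 𝓝 p, q ∈ Ω ∧ q ∉ E ∧ ∀ k, |g k q| ≤ B := by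
      filter_upwards [hC, h2, hfin, hΩ.mem_nhds hp] with q h1 h2 h3 h4
      refine ⟨h4, ?_, ?_⟩
      · intro hqE
        obtain ⟨C3, hC3⟩ := hE q h4 hqE
        exact aux_notsum hC3 (aux_sum h1 h2)
      · intro k
        have a1 := abs_nonneg C
        have a2 := abs_nonneg C2
        by_cases hk : k < k0
        · have := h3 k (Finset.mem_range.2 hk)
          have := hsum0 k (Finset.mem_range.2 hk)
          linarith
        · rw [abs_le]
          have := h1 k
          have := h2 k (not_lt.1 hk)
          have := le_abs_self C
          have := le_abs_self C2
          constructor <;> linarith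
    obtain ⟨U, hU, hUo, hpU⟩ := _root_.eventually_nhds_iff.1 hall
    have hc : ContinuousOn (fun q => ∑' k, (1/2:ℝ)^k * g k q) U := by
      refine continuousOn_tsum (u := fun k => (1/2:ℝ)^k * B) ?_
        (summable_geometric_two.mul_right _) ?_
      · intro k
        exact ((hg k).mono (fun q hq => (hU q hq).1)).const_mul _
      · intro k q hq
        rw [norm_mul, Real.norm_of_nonneg (by positivity)]
        gcongr
        exact (hU q hq).2.2 k
    have hc2 := continuous_coe_real_ereal.continuousAt.comp (hc.continuousAt (hUo.mem_nhds hpU))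
    refine hc2.congr ?_
    filter_upwards [hUo.mem_nhds hpU] with q hq
    simp [uS, (hU q hq).2.1]

lemma aux_expE {u : ℂ × ℂ → EReal} {Ω : Set (ℂ × ℂ)} (hu : ContinuousOn u Ω)
    (ht : ∀ p, u p ≠ ⊤) : ContinuousOn (fun p => expEReal (u p)) Ω := by
  have e : (fun p => expEReal (u p)) = fun p => (EReal.exp (u p)).toReal := by
    ext p
    have := ht p
    induction h : u p using EReal.rec with
    | bot => simp [expEReal]
    | top => exact absurd h this
    | coe x => simp [expEReal, EReal.exp_coe, (Real.exp_pos x).le]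
  rw [e]
  intro p hp
  have h1 : ContinuousWithinAt (fun p => EReal.exp (u p)) Ω p :=
    (ENNReal.continuous_exp.continuousAt).comp_continuousWithinAt (hu p hp)
  exact (ENNReal.tendsto_toReal (by
    have := ht p
    simpa [EReal.exp_eq_top_iff] using this)).comp h1

lemma aux_L1 {μ : Measure ℝ} {F : ℕ → ℝ → ℝ} (hF : ∀ k, Continuous (F k))
    (h0 : ∀ k x, 0 ≤ F k x) (hi : ∀ k, Integrable (F k) μ)
    (hs : Summable (fun k => ∫ x, F k x ∂μ)) :
    (∀ᵐ x ∂μ, Summable (fun k => F k x)) ∧ Integrable (fun x => ∑' k, F k x) μ ∧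
      ∫ x, ∑' k, F k x ∂μ = ∑' k, ∫ x, F k x ∂μ := by
  have hm : ∀ k, Measurable (fun x => ENNReal.ofReal (F k x)) := fun k =>
    (hF k).measurable.ennreal_ofReal
  have hl : ∫⁻ x, ∑' k, ENNReal.ofReal (F k x) ∂μ ≠ ⊤ := by
    rw [lintegral_tsum (fun k => (hm k).aemeasurable)]
    have : ∀ k, ∫⁻ x, ENNReal.ofReal (F k x) ∂μ = ENNReal.ofReal (∫ x, F k x ∂μ) := fun k =>
      (ofReal_integral_eq_lintegral_ofReal (hi k) (ae_of_all _ (h0 k))).symm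
    simp_rw [this]
    exact hs.tsum_ofReal_ne_top
  have hM : Measurable (fun x => ∑' k, ENNReal.ofReal (F k x)) := Measurable.tsum hm
  have he : (fun x => ∑' k, F k x) = fun x => (∑' k, ENNReal.ofReal (F k x)).toReal := by
    ext x
    rw [ENNReal.tsum_toReal_eq (fun k => ENNReal.ofReal_ne_top)]
    exact tsum_congr (fun k => (ENNReal.toReal_ofReal (h0 k x)).symm)
  refine ⟨?_, ?_, ?_⟩
  · filter_upwards [ae_lt_top hM hl] with x hx
    have := ENNReal.summable_toReal hx.ne
    refine this.congr (fun k => ?_)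
    exact (ENNReal.toReal_ofReal (h0 k x))
  · rw [he]
    exact integrable_toReal_of_lintegral_ne_top hM.aemeasurable hl
  · refine (integral_tsum_of_summable_integral_norm hi ?_).symm
    refine hs.congr (fun k => ?_)
    exact integral_congr_ae (ae_of_all _ fun x => by simp [Real.norm_of_nonneg (h0 k x)])

lemma aux_uS_sub {Ω E : Set (ℂ × ℂ)} {g : ℕ → ℂ × ℂ → ℝ}
    (hg : ∀ k, ContinuousOn (g k) Ω)
    (hsm : ∀ k, ∀ a b : ℂ × ℂ, ∀ c : ℂ, ∀ r : ℝ, 0 < r →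
        (∀ l ∈ Metric.closedBall c r, a + l • b ∈ Ω) →
        g k (a + c • b) ≤ Real.circleAverage (fun l : ℂ => g k (a + l • b)) c r)
    (hup : ∀ p ∈ Ω, ∃ C, ∀ᶠ q in 𝓝 p, ∀ k, g k q ≤ C)
    (hE : ∀ p ∈ Ω, p ∈ E → ∃ C, ∀ᶠ k in atTop, g k p ≤ -2^k + C)
    (hnE : ∀ p ∈ Ω, p ∉ E → ∃ C, ∃ k0, ∀ᶠ q in 𝓝 p, ∀ k ≥ k0, -C ≤ g k q)
    (a b : ℂ × ℂ) (c : ℂ) (r : ℝ) (hr : 0 < r)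
    (hd : ∀ l ∈ Metric.closedBall c r, a + l • b ∈ Ω) :
    uS E g (a + c • b) ≤ circleAvg (fun l : ℂ => uS E g (a + l • b)) c r := by
  by_cases hcE : a + c • b ∈ E
  · simp [uS, hcE]
  have hL : Continuous (fun l : ℂ => a + l • b) := by fun_prop
  obtain ⟨C, hC⟩ : ∃ C, ∀ q ∈ (fun l : ℂ => a + l • b) '' closedBall c r, ∀ k, g k q ≤ C := by
    refine ((isCompact_closedBall c r).image hL).induction_on
      (p := fun s => ∃ C, ∀ q ∈ s, ∀ k, g k q ≤ C) ⟨0, by simp⟩ ?_ ?_ ?_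
    · rintro s t hst ⟨C, h⟩
      exact ⟨C, fun q hq => h q (hst hq)⟩
    · rintro s t ⟨C, h⟩ ⟨C', h'⟩
      refine ⟨max C C', ?_⟩
      rintro q (hq | hq) k
      · exact (h q hq k).trans (le_max_left _ _)
      · exact (h' q hq k).trans (le_max_right _ _)
    · rintro _ ⟨l, hl, rfl⟩
      obtain ⟨C, h⟩ := hup _ (hd l hl)
      exact ⟨_, mem_nhdsWithin_of_mem_nhds h, C, fun q hq => hq⟩
  have hC' : ∀ l ∈ closedBall c r, ∀ k, g k (a + l • b) ≤ C := fun l hl =>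
    hC _ (mem_image_of_mem _ hl)
  have hcm : ∀ θ, circleMap c r θ ∈ closedBall c r := fun θ => circleMap_mem_closedBall c hr.le θ
  have hcc : c ∈ closedBall c r := mem_closedBall_self hr.le
  have hsE : ∀ l ∈ closedBall c r, (a + l • b ∉ E ↔
      Summable (fun k => (1/2:ℝ)^k * (C - g k (a + l • b)))) := by
    intro l hl
    constructor
    · intro h
      obtain ⟨C2, k0, h2⟩ := hnE _ (hd l hl) h
      exact (aux_tail (aux_sum (hC' l hl) h2.self_of_nhds)).1
    · intro h hh
      obtain ⟨C3, h3⟩ := hE _ (hd l hl) hh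
      exact aux_notsum h3 (aux_tail' h)
  have huv : ∀ l ∈ closedBall c r, a + l • b ∉ E → uS E g (a + l • b) =
      ((2 * C - ∑' k, (1/2:ℝ)^k * (C - g k (a + l • b)) : ℝ) : EReal) := by
    intro l hl h
    simp only [uS, h, if_false]
    rw [(aux_tail (C := C) (aux_tail' ((hsE l hl).1 h))).2]
  set F : ℕ → ℝ → ℝ := fun k θ => (1/2:ℝ)^k * (C - g k (a + circleMap c r θ • b)) with hFdef
  have hgc : ∀ k, Continuous (fun θ => g k (a + circleMap c r θ • b)) := fun k =>
    (hg k).comp_continuous (by fun_prop) (fun θ => hd _ (hcm θ))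
  have hFc : ∀ k, Continuous (F k) := fun k => (continuous_const.sub (hgc k)).const_mul _
  have hF0 : ∀ k θ, 0 ≤ F k θ := fun k θ =>
    mul_nonneg (by positivity) (sub_nonneg.2 (hC' _ (hcm θ) k))
  set μ := volume.restrict (Set.Ioc (0:ℝ) (2 * Real.pi)) with hμ
  have hpi : (0:ℝ) < 2 * Real.pi := by positivity
  have hFi : ∀ k, Integrable (F k) μ := fun k =>
    ((hFc k).intervalIntegrable 0 (2 * Real.pi)).1
  have hFb : ∀ k, ∫ θ, F k θ ∂μ ≤ 2 * Real.pi * ((1/2:ℝ)^k * (C - g k (a + c • b))) := by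
    intro k
    have h1 := hsm k a b c r hr hd
    rw [Real.circleAverage_def, smul_eq_mul, le_inv_mul_iff₀ hpi] at h1
    rw [hμ, ← intervalIntegral.integral_of_le hpi.le]
    simp only [hFdef]
    rw [intervalIntegral.integral_const_mul, intervalIntegral.integral_sub
      (intervalIntegrable_const) ((hgc k).intervalIntegrable _ _), intervalIntegral.integral_const]
    have h2 : (0:ℝ) < (1/2)^k := by positivity
    simp only [sub_zero, smul_eq_mul]
    have h3 := mul_le_mul_of_nonneg_left h1 h2.le
    linarith
  have hsc := (hsE c hcc).1 hcE
  have hsI : Summable (fun k => ∫ θ, F k θ ∂μ) :=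
    Summable.of_nonneg_of_le (fun k => integral_nonneg (hF0 k)) hFb (hsc.mul_left _)
  obtain ⟨hae, hintg, heq⟩ := aux_L1 hFc hF0 hFi hsI
  have hae' : ∀ᵐ θ ∂μ, uS E g (a + circleMap c r θ • b) = ((2 * C - ∑' k, F k θ : ℝ) : EReal) := by
    filter_upwards [hae] with θ hθ
    exact huv _ (hcm θ) ((hsE _ (hcm θ)).2 hθ)
  have hae2 : (fun θ => 2 * C - ∑' k, F k θ) =ᵐ[μ]
      fun θ => (uS E g (a + circleMap c r θ • b)).toReal := by
    filter_upwards [hae'] with θ hθ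
    rw [hθ, EReal.toReal_coe]
  have hfin : IsFiniteMeasure μ := by rw [hμ]; infer_instance
  have hintg2 : Integrable (fun θ => 2 * C - ∑' k, F k θ) μ := (integrable_const _).sub hintg
  unfold circleAvg
  rw [if_pos, huv c hcc hcE, EReal.coe_le_coe_iff, le_div_iff₀ hpi,
    intervalIntegral.integral_of_le hpi.le, ← hμ, ← integral_congr_ae hae2,
    integral_sub (integrable_const _) hintg, heq]
  · have h5 := hsI.tsum_le_tsum hFb (hsc.mul_left _)
    rw [tsum_mul_left] at h5
    have h6 : ∫ θ, 2 * C ∂μ = 2 * Real.pi * (2 * C) := by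
      rw [hμ, ← intervalIntegral.integral_of_le hpi.le, intervalIntegral.integral_const]
      simp only [sub_zero, smul_eq_mul]
    rw [h6]
    linarith
  · refine ⟨?_, ?_⟩
    · rw [intervalIntegrable_iff_integrableOn_Ioc_of_le hpi.le]
      exact hintg2.congr hae2
    · filter_upwards [hae'] with θ hθ
      rw [hθ]
      exact EReal.coe_ne_bot _

/-- For `K` compact polar in a domain `D ⊆ ℂ` and `f` holomorphic on
`D \ K`, there is a plurisubharmonic `u` on `D × ℂ` with `e^u` continuous whose `-∞`-set
is exactly `Γ_f ∪ (K × ℂ)`. -/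
theorem statement5 (D K : Set ℂ) (f : ℂ → ℂ)
    (hD : IsOpen D) (hDconn : IsConnected D)
    (hKD : K ⊆ D) (hKcpt : IsCompact K) (hKpolar : PolarSet K)
    (hf : DifferentiableOn ℂ f (D \ K)) :
    ∃ u : ℂ × ℂ → EReal, PSHOn u (D ×ˢ (Set.univ : Set ℂ)) ∧
      ContinuousOn (fun p => expEReal (u p)) (D ×ˢ (Set.univ : Set ℂ)) ∧
      ∀ p ∈ D ×ˢ (Set.univ : Set ℂ),
        (u p = ⊥ ↔ p ∈ graphOver f (D \ K) ∪ K ×ˢ (Set.univ : Set ℂ)) := by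
  obtain ⟨b, hb, hbD⟩ := hKcpt.exists_cthickening_subset_open hD hKD
  obtain ⟨C0, hC0⟩ := hKcpt.isBounded.exists_norm_le
  have hst := fun k : ℕ => aux_stage hD hKcpt hKpolar hf hb hbD hC0
    (M := 2^k + 1) (r0 := 1 / ((k:ℝ) + 1)) (by positivity) (by positivity)
  choose g hgc hgs hg1 hg2 hg3 hg4 hg5 using hst
  set E := graphOver f (D \ K) ∪ K ×ˢ (Set.univ : Set ℂ) with hEdef
  have hDK : IsOpen (D \ K) := hD.sdiff hKcpt.isClosed
  have hΩ : IsOpen (D ×ˢ (Set.univ : Set ℂ)) := hD.prod isOpen_univ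
  have hfc : ∀ z ∈ D \ K, ContinuousAt f z := fun z hz =>
    (hf.differentiableAt (hDK.mem_nhds hz)).continuousAt
  have hsep : ∀ z ∈ D \ K, ∃ d > 0, (∀ᶠ x in 𝓝 z, x ∉ thickening d K) := by
    intro z hz
    obtain ⟨d, hd, hball⟩ := Metric.isOpen_iff.1 hKcpt.isClosed.isOpen_compl z hz.2
    refine ⟨d/2, by positivity, ?_⟩
    filter_upwards [ball_mem_nhds z (half_pos hd)] with x hx hx2
    obtain ⟨y, hy, hxy⟩ := mem_thickening_iff.1 hx2
    refine hball ?_ hy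
    rw [mem_ball] at hx ⊢
    have := dist_triangle y x z
    rw [dist_comm y x] at this
    linarith
  have hup : ∀ p ∈ D ×ˢ (Set.univ : Set ℂ), ∃ C, ∀ᶠ q in 𝓝 p, ∀ k, g k q ≤ C := by
    rintro ⟨z, w⟩ ⟨hz, -⟩
    by_cases hzK : z ∈ K
    · have hc : ContinuousAt (fun q : ℂ × ℂ => lpx ‖q.2‖ + lpx (‖q.1‖ + C0) + 1) (z, w) := by
        have := lpx_cont
        fun_prop
      refine ⟨lpx ‖w‖ + lpx (‖z‖ + C0) + 1 + 1, ?_⟩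
      have h1 : ∀ᶠ q : ℂ × ℂ in 𝓝 (z, w), q.1 ∈ thickening b K :=
        continuousAt_fst.eventually (isOpen_thickening.mem_nhds (self_subset_thickening hb K hzK))
      filter_upwards [h1, hc.eventually (gt_mem_nhds (lt_add_one _))] with q hq hq2 k
      exact (hg1 k q.1 (thickening_subset_cthickening _ _ hq) q.2).trans hq2.le
    · have hfz := hfc z ⟨hz, hzK⟩
      have hc : ContinuousAt (fun q : ℂ × ℂ =>
          lpx ‖q.2‖ + lpx ‖q.2 - f q.1‖ + lpx (‖q.1‖ + C0) + 1) (z, w) := by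
        have h1 : ContinuousAt (fun q : ℂ × ℂ => f q.1) (z, w) :=
          ContinuousAt.comp (f := Prod.fst) (g := f) hfz continuousAt_fst
        have h2 : ContinuousAt (fun q : ℂ × ℂ => lpx ‖q.2 - f q.1‖) (z, w) :=
          lpx_cont.continuousAt.comp (continuousAt_snd.sub h1).norm
        have := lpx_cont
        fun_prop
      refine ⟨lpx ‖w‖ + lpx ‖w - f z‖ + lpx (‖z‖ + C0) + 1 + 1, ?_⟩
      have h1 : ∀ᶠ q : ℂ × ℂ in 𝓝 (z, w), q.1 ∈ D \ K :=
        continuousAt_fst.eventually (hDK.mem_nhds ⟨hz, hzK⟩)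
      filter_upwards [h1, hc.eventually (gt_mem_nhds (lt_add_one _))] with q hq hq2 k
      exact (hg2 k q.1 hq q.2).trans hq2.le
  have hlim : ∀ d : ℝ, 0 < d → ∀ᶠ k : ℕ in atTop, 1 / ((k:ℝ) + 1) < d := fun d hd =>
    tendsto_one_div_add_atTop_nhds_zero_nat.eventually (gt_mem_nhds hd)
  have hE : ∀ p ∈ D ×ˢ (Set.univ : Set ℂ), p ∈ E →
      ∃ C, ∀ᶠ k in atTop, g k p ≤ -2^k + C := by
    rintro ⟨z, w⟩ ⟨hz, -⟩ (⟨hzDK, hw⟩ | ⟨hzK, -⟩)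
    · simp only at hw hzDK
      obtain ⟨d, hd, hdz⟩ := hsep z hzDK
      refine ⟨lpx ‖f z‖, ?_⟩
      filter_upwards [hlim d hd] with k hk
      have := hg4 k z hz (fun h => hdz.self_of_nhds (thickening_mono hk.le _ h))
      rw [hw]
      linarith
    · refine ⟨lpx ‖w‖, Eventually.of_forall fun k => ?_⟩
      have := hg3 k z hzK w
      linarith
  have hnE : ∀ p ∈ D ×ˢ (Set.univ : Set ℂ), p ∉ E →
      ∃ C, ∃ k0, ∀ᶠ q in 𝓝 p, ∀ k ≥ k0, -C ≤ g k q := by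
    rintro ⟨z, w⟩ ⟨hz, -⟩ hnE
    simp only at hz
    have hzK : z ∉ K := fun h => hnE (Or.inr ⟨h, mem_univ _⟩)
    have hw : w ≠ f z := fun h => hnE (Or.inl ⟨⟨hz, hzK⟩, h⟩)
    obtain ⟨d, hd, hdz⟩ := hsep z ⟨hz, hzK⟩
    obtain ⟨k0, hk0⟩ := eventually_atTop.1 (hlim d hd)
    have h1 : ContinuousAt (fun q : ℂ × ℂ => f q.1) (z, w) :=
      ContinuousAt.comp (f := Prod.fst) (g := f) (hfc z ⟨hz, hzK⟩) continuousAt_fst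
    have h2 : ContinuousAt (fun q : ℂ × ℂ => q.2 - f q.1) (z, w) := continuousAt_snd.sub h1
    have h3 : ContinuousAt (fun q : ℂ × ℂ => |Real.log ‖q.2 - f q.1‖|) (z, w) :=
      (h2.norm.log (norm_ne_zero_iff.2 (sub_ne_zero.2 hw))).abs
    refine ⟨|Real.log ‖w - f z‖| + 1 + |Real.log d|, k0, ?_⟩
    have h4 : ∀ᶠ q : ℂ × ℂ in 𝓝 (z, w), q.1 ∈ D \ K :=
      continuousAt_fst.eventually (hDK.mem_nhds ⟨hz, hzK⟩)
    have h5 : ∀ᶠ q : ℂ × ℂ in 𝓝 (z, w), q.1 ∉ thickening d K :=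
      (continuousAt_fst (p := ((z, w) : ℂ × ℂ))).eventually hdz
    filter_upwards [h4, h5, h2.eventually_ne (sub_ne_zero.2 hw),
      h3.eventually (gt_mem_nhds (lt_add_one _))] with q q1 q2 q3 q4 k hk
    have := hg5 k d hd q.1 q1.1 (fun h => q2 (thickening_mono (hk0 k hk).le _ h)) q2 q.2
      (sub_ne_zero.1 q3)
    linarith
  have hcont := aux_uS_cont hΩ hgc hup hE hnE
  have htop : ∀ p, uS E g p ≠ ⊤ := by
    intro p
    unfold uS
    split_ifs <;> simp
  have hbot : ∀ p, uS E g p = ⊥ ↔ p ∈ E := by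
    intro p
    unfold uS
    split_ifs with h <;> simp [h]
  refine ⟨uS E g, ⟨fun z _ => htop z, hcont.upperSemicontinuousOn, ?_, ?_⟩,
    aux_expE hcont htop, fun p _ => hbot p⟩
  · intro p hp
    have hpc : IsPreconnected (D ×ˢ (Set.univ : Set ℂ)) :=
      hDconn.isPreconnected.prod isPreconnected_univ
    obtain ⟨z, hz⟩ : (D \ K).Nonempty := by
      by_contra hne
      rw [not_nonempty_iff_eq_empty, sdiff_eq_empty] at hne
      have hDK : D = K := hne.antisymm hKD
      have hcl : IsClopen D := ⟨hDK ▸ hKcpt.isClosed, hD⟩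
      have hun := hcl.eq_univ hDconn.nonempty
      rw [hDK] at hun
      rw [hun] at hKcpt
      exact noncompact_univ ℂ hKcpt
    refine ⟨(z, f z + 1), ?_, ?_⟩
    · rw [hpc.connectedComponentIn hp]
      exact ⟨hz.1, mem_univ _⟩
    · rw [Ne, hbot]
      rintro (⟨-, h⟩ | ⟨h, -⟩)
      · simp at h
      · exact hz.2 h
  · intro a b c r hr hd
    exact aux_uS_sub hgc hgs hup hE hnE a b c r hr hd
end

section
/- Let G be a domain in ℂ and let E ⊆ G × ℂ be a pluripolar set in G × ℂ which is both an F_σ set and a G_δ set. Then E is complete pluripolar in G × ℂ if and only if for every subdomain D with compact closure contained in G, the set E ∩ (D × ℂ) is complete pluripolar in D × ℂ. -/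
open Set Metric MeasureTheory Filter Topology

section
theorem circInt_of_usc {f : ℂ → ℝ} {c : ℂ} {r : ℝ} (hr : 0 < r)
    (hf : UpperSemicontinuousOn f (sphere c r)) {m : ℝ} (hm : ∀ z ∈ sphere c r, m ≤ f z) :
    CircleIntegrable f c r := by
  have hmem : ∀ θ, circleMap c r θ ∈ sphere c r := fun θ => circleMap_mem_sphere c hr.le θ
  have husc : UpperSemicontinuous (fun θ : ℝ => f (circleMap c r θ)) := by
    rw [← upperSemicontinuousOn_univ_iff]
    exact hf.comp (continuous_circleMap c r).continuousOn (fun θ _ => hmem θ)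
  obtain ⟨M, hM⟩ := hf.bddAbove_of_isCompact (isCompact_sphere c r)
  have hM' : ∀ z ∈ sphere c r, f z ≤ M := fun z hz => hM ⟨z, hz, rfl⟩
  unfold CircleIntegrable
  rw [intervalIntegrable_iff]
  refine Measure.integrableOn_of_bounded (M := max |M| |m|) (by rw [uIoc_of_le Real.two_pi_pos.le]; exact measure_Ioc_lt_top.ne)
    husc.measurable.aestronglyMeasurable (Eventually.of_forall fun θ => ?_)
  have h1 := hm _ (hmem θ)
  have h2 := hM' _ (hmem θ)
  rw [Real.norm_eq_abs, abs_le]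
  constructor
  · have := neg_abs_le m; have := le_max_right |M| |m|; linarith
  · have := le_abs_self M; have := le_max_left |M| |m|; linarith

theorem reAvg {F : ℂ → ℂ} (hF : Differentiable ℂ F) (z : ℂ) (s : ℝ) :
    Real.circleAverage (fun w => (F w).re) z s = (F z).re := by
  have h1 : CircleIntegrable F z s := hF.continuous.continuousOn.circleIntegrable'
  have h2 := Complex.reCLM.circleAverage_comp_comm h1
  have h3 : Real.circleAverage F z s = F z := hF.diffContOnCl.circleAverage
  rw [h3] at h2
  exact h2

theorem maxPrinciple {g : ℂ → ℝ} {c : ℂ} {r K m : ℝ} (hr : 0 < r)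
    (hg : UpperSemicontinuousOn g (closedBall c r)) (hm : ∀ z ∈ closedBall c r, m ≤ g z)
    (hloc : ∀ z ∈ ball c r, ∃ s > 0, closedBall z s ⊆ closedBall c r ∧
      g z ≤ Real.circleAverage g z s)
    (hK : ∀ z ∈ sphere c r, g z ≤ K) : g c ≤ K := by
  by_contra! hlt
  obtain ⟨ε, hε, hεr⟩ : ∃ ε > 0, ε * r ^ 2 < g c - K := by
    refine ⟨(g c - K) / (2 * r ^ 2), by have : 0 < g c - K := by linarith
                                        positivity, ?_⟩
    have : 0 < r ^ 2 := by positivity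
    field_simp
    linarith
  set q : ℂ → ℝ := fun z => ε * ‖z - c‖ ^ 2 with hq
  have hqc : Continuous q := by fun_prop
  have husc : UpperSemicontinuousOn (fun z => g z + q z) (closedBall c r) :=
    hg.add (hqc.upperSemicontinuous.upperSemicontinuousOn _)
  obtain ⟨z0, hz0, hmax⟩ := husc.exists_isMaxOn ⟨c, mem_closedBall_self hr.le⟩
    (isCompact_closedBall c r)
  have hmax' : ∀ z ∈ closedBall c r, g z + q z ≤ g z0 + q z0 := fun z hz => hmax hz
  have hb : z0 ∈ ball c r := by
    by_contra hnb
    have hs : z0 ∈ sphere c r := by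
      rw [mem_closedBall] at hz0
      rw [mem_ball, not_lt] at hnb
      exact le_antisymm hz0 hnb
    have h1 := hmax' c (mem_closedBall_self hr.le)
    have h2 := hK z0 hs
    rw [mem_sphere_iff_norm] at hs
    simp only [hq, hs, sub_self, norm_zero] at h1
    nlinarith
  obtain ⟨s, hs, hsub, hle⟩ := hloc z0 hb
  have hsub' : sphere z0 s ⊆ closedBall c r := sphere_subset_closedBall.trans hsub
  have hig : CircleIntegrable g z0 s :=
    circInt_of_usc hs (hg.mono hsub') (fun z hz => hm z (hsub' hz))
  have hiq : CircleIntegrable q z0 s := hqc.continuousOn.circleIntegrable'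
  have hav := Real.circleAverage_fun_add hig hiq
  have hle2 : Real.circleAverage (fun z => g z + q z) z0 s ≤ g z0 + q z0 := by
    apply Real.circleAverage_mono_on_of_le_circle (hig.add hiq)
    intro x hx
    rw [abs_of_pos hs] at hx
    exact hmax' x (hsub' hx)
  have hqav : Real.circleAverage q z0 s = q z0 + ε * s ^ 2 := by
    have h1 : Real.circleAverage q z0 s = Real.circleAverage (fun w =>
        ((ε * (‖z0 - c‖ ^ 2 + s ^ 2) : ℝ) + 2 * ε * (w - z0) * (starRingEnd ℂ) (z0 - c) : ℂ).re) z0 s := by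
      apply Real.circleAverage_congr_sphere
      intro w hw
      rw [abs_of_pos hs, mem_sphere_iff_norm] at hw
      have e1 : w - c = (w - z0) + (z0 - c) := by ring
      simp only [hq]
      rw [e1, ← hw]
      generalize w - z0 = a
      generalize z0 - c = b
      rw [← Complex.normSq_eq_norm_sq, ← Complex.normSq_eq_norm_sq, ← Complex.normSq_eq_norm_sq]
      simp [Complex.normSq_apply]
      ring
    rw [h1, reAvg (by fun_prop)]
    simp [hq, -Complex.ofReal_pow, -Complex.ofReal_mul, -Complex.ofReal_add]
    ring
  have : 0 < ε * s ^ 2 := by positivity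
  linarith

/-- trigonometric polynomials are boundary values of real parts of entire functions -/
theorem trig_ext {c : ℂ} {r : ℝ} (hr : 0 < r) [Fact (0 < 2 * Real.pi)]
    (q : C(AddCircle (2 * Real.pi), ℂ))
    (hq : q ∈ Submodule.span ℂ (range (@fourier (2 * Real.pi)))) :
    ∀ a : ℂ, ∃ P : ℂ → ℂ, Differentiable ℂ P ∧
      ∀ θ : ℝ, (P (circleMap c r θ)).re = (a * q (θ : AddCircle (2 * Real.pi))).re := by
  have hr' : (r : ℂ) ≠ 0 := by exact_mod_cast hr.ne'
  have hcm : ∀ θ : ℝ, (circleMap c r θ - c) / r = Complex.exp (θ * Complex.I) := by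
    intro θ
    simp [circleMap, hr']
  have hf : ∀ (n : ℤ) (θ : ℝ), fourier n (θ : AddCircle (2 * Real.pi))
      = Complex.exp (n * (θ * Complex.I)) := by
    intro n θ
    rw [fourier_coe_apply]
    congr 1
    have : (Real.pi : ℂ) ≠ 0 := by exact_mod_cast Real.pi_ne_zero
    push_cast
    field_simp
  induction hq using Submodule.span_induction with
  | mem x hx =>
    obtain ⟨n, rfl⟩ := hx
    intro a
    rcases le_total 0 n with hn | hn
    · lift n to ℕ using hn
      refine ⟨fun z => a * ((z - c) / r) ^ n, by fun_prop, fun θ => ?_⟩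
      simp only [hcm, hf, ← Complex.exp_nat_mul]
      simp
    · obtain ⟨k, rfl⟩ : ∃ k : ℕ, n = -(k : ℤ) := ⟨n.natAbs, by omega⟩
      refine ⟨fun z => (starRingEnd ℂ) a * ((z - c) / r) ^ k, by fun_prop, fun θ => ?_⟩
      simp only [hcm, hf, ← Complex.exp_nat_mul]
      rw [← Complex.conj_re, map_mul, Complex.conj_conj, ← Complex.exp_conj]
      simp
  | zero => exact fun a => ⟨fun _ => 0, by fun_prop, by simp⟩
  | add x y _ _ hx hy =>
    intro a
    obtain ⟨P, hP, h1⟩ := hx a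
    obtain ⟨Q, hQ, h2⟩ := hy a
    refine ⟨fun z => P z + Q z, by fun_prop, fun θ => ?_⟩
    simp only [Complex.add_re, h1, h2, ContinuousMap.add_apply, mul_add]
  | smul b x _ hx =>
    intro a
    obtain ⟨P, hP, h1⟩ := hx (a * b)
    refine ⟨P, hP, fun θ => ?_⟩
    rw [h1]
    simp [mul_assoc]

theorem trig_approx {c : ℂ} {r : ℝ} (hr : 0 < r) {φ : ℝ → ℝ} (hφ : Continuous φ)
    (hper : Function.Periodic φ (2 * Real.pi)) {ε : ℝ} (hε : 0 < ε) :
    ∃ P : ℂ → ℂ, Differentiable ℂ P ∧ ∀ θ : ℝ, |(P (circleMap c r θ)).re - φ θ| < ε := by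
  have : Fact (0 < 2 * Real.pi) := ⟨Real.two_pi_pos⟩
  have hcl : Continuous (fun x : AddCircle (2 * Real.pi) => ((hper.lift x : ℝ) : ℂ)) := by
    apply Complex.continuous_ofReal.comp
    exact hφ.quotient_lift _
  let Φ : C(AddCircle (2 * Real.pi), ℂ) := ⟨_, hcl⟩
  have hΦ : Φ ∈ (Submodule.span ℂ (range <| @fourier (2 * Real.pi))).topologicalClosure := by
    rw [span_fourier_closure_eq_top]; trivial
  rw [← SetLike.mem_coe, Submodule.topologicalClosure_coe, Metric.mem_closure_iff] at hΦ
  obtain ⟨q, hq, hd⟩ := hΦ ε hε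
  obtain ⟨P, hP, h⟩ := trig_ext (c := c) hr q hq 1
  refine ⟨P, hP, fun θ => ?_⟩
  rw [h θ, one_mul]
  have h1 : dist (Φ θ) (q θ) < ε := (ContinuousMap.dist_apply_le_dist _).trans_lt hd
  have h2 : Φ (θ : AddCircle (2 * Real.pi)) = ((φ θ : ℝ) : ℂ) := rfl
  rw [h2, dist_comm, Complex.dist_eq] at h1
  refine lt_of_le_of_lt ?_ h1
  have := Complex.abs_re_le_norm (q θ - (φ θ : ℂ))
  simpa using this

theorem le_of_cont {f : ℂ → ℝ} {c : ℂ} {r m : ℝ} (hr : 0 < r)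
    (hg : UpperSemicontinuousOn f (closedBall c r)) (hm : ∀ z ∈ closedBall c r, m ≤ f z)
    (hloc : ∀ z ∈ ball c r, ∃ s > 0, closedBall z s ⊆ closedBall c r ∧
      f z ≤ Real.circleAverage f z s)
    {φ : ℝ → ℝ} (hφ : Continuous φ)
    (hper : Function.Periodic φ (2 * Real.pi)) (hle : ∀ θ, f (circleMap c r θ) ≤ φ θ) :
    f c ≤ (2 * Real.pi)⁻¹ * ∫ θ in (0 : ℝ)..(2 * Real.pi), φ θ := by
  apply le_of_forall_pos_le_add
  intro ε hε
  obtain ⟨P, hP, hPφ⟩ := trig_approx (c := c) hr hφ hper (half_pos hε)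
  have hPc : Continuous (fun z => (P z).re) := Complex.continuous_re.comp hP.continuous
  have hPn : Continuous (fun z => - (P z).re) := hPc.neg
  obtain ⟨B, hB⟩ := (isCompact_closedBall c r).bddBelow_image hPn.continuousOn
  have key : f c + - (P c).re ≤ ε / 2 := by
    refine maxPrinciple (g := fun z => f z + - (P z).re) (m := m + B) hr
      (hg.add (hPn.upperSemicontinuous.upperSemicontinuousOn _)) ?_ ?_ ?_
    · intro z hz
      exact add_le_add (hm z hz) (hB ⟨z, hz, rfl⟩)
    · intro z hz
      obtain ⟨s, hs, hsub, hsle⟩ := hloc z hz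
      refine ⟨s, hs, hsub, ?_⟩
      have hsub' : sphere z s ⊆ closedBall c r := sphere_subset_closedBall.trans hsub
      rw [Real.circleAverage_fun_add (circInt_of_usc hs (hg.mono hsub')
        (fun z hz => hm z (hsub' hz))) hPn.continuousOn.circleIntegrable']
      have : Real.circleAverage (fun z => - (P z).re) z s = - (P z).re := by
        have := reAvg (F := fun z => - P z) (by fun_prop) z s
        simpa using this
      rw [this]
      linarith
    · intro z hz
      obtain ⟨θ, rfl⟩ : z ∈ range (circleMap c r) := by
        rw [range_circleMap, abs_of_pos hr]; exact hz
      have h1 := hle θ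
      have h2 := (abs_lt.1 (hPφ θ)).1
      show f _ + - _ ≤ _
      linarith
  have h3 : (P c).re ≤ (2 * Real.pi)⁻¹ * (∫ θ in (0 : ℝ)..(2 * Real.pi), φ θ) + ε / 2 := by
    rw [← reAvg hP c r, Real.circleAverage_def, smul_eq_mul]
    have h4 : ∫ θ in (0 : ℝ)..(2 * Real.pi), (P (circleMap c r θ)).re ≤
        ∫ θ in (0 : ℝ)..(2 * Real.pi), (φ θ + ε / 2) := by
      apply intervalIntegral.integral_mono_on Real.two_pi_pos.le
      · exact (hPc.comp (continuous_circleMap c r)).intervalIntegrable _ _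
      · exact (hφ.add continuous_const).intervalIntegrable _ _
      · intro θ _
        have h2 := (abs_lt.1 (hPφ θ)).2
        linarith
    rw [intervalIntegral.integral_add (hφ.intervalIntegrable _ _) (by simp)] at h4
    simp only [intervalIntegral.integral_const, sub_zero, smul_eq_mul] at h4
    have h5 := mul_le_mul_of_nonneg_left h4 (inv_nonneg.2 Real.two_pi_pos.le)
    refine h5.trans (le_of_eq ?_)
    have := Real.pi_pos
    field_simp
  linarith

end

section
theorem usc_approx {F : ℝ → ℝ} (hF : UpperSemicontinuous F) {T m M : ℝ}
    (hper : Function.Periodic F T) (hm : ∀ x, m ≤ F x) (hM : ∀ x, F x ≤ M) :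
    ∃ φ : ℕ → ℝ → ℝ, (∀ n, Continuous (φ n)) ∧ (∀ n, Function.Periodic (φ n) T) ∧
      (∀ n x, F x ≤ φ n x) ∧ (∀ n x, φ n x ≤ M) ∧ ∀ x, Tendsto (fun n => φ n x) atTop (𝓝 (F x)) := by
  have hle : ∀ (n : ℕ) (x y : ℝ), F y - n * |x - y| ≤ M := by
    intro n x y
    have : 0 ≤ (n : ℝ) * |x - y| := by positivity
    linarith [hM y]
  have hbdd : ∀ (n : ℕ) (x : ℝ), BddAbove (range fun y => F y - n * |x - y|) := by
    intro n x
    exact ⟨M, by rintro _ ⟨y, rfl⟩; exact hle n x y⟩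
  have hFle : ∀ (n : ℕ) x, F x ≤ ⨆ y, (F y - n * |x - y|) := by
    intro n x
    have := le_ciSup (hbdd n x) x
    simpa using this
  refine ⟨fun n x => ⨆ y, (F y - n * |x - y|), ?_, ?_, hFle, ?_, ?_⟩
  · intro n
    apply LipschitzWith.continuous (K := (n : NNReal))
    apply LipschitzWith.of_le_add_mul
    intro x x'
    apply ciSup_le
    intro y
    have h1 := le_ciSup (hbdd n x') y
    have h2 : |x' - y| ≤ |x' - x| + |x - y| := abs_sub_le _ _ _
    have h3 := mul_le_mul_of_nonneg_left h2 (Nat.cast_nonneg (α := ℝ) n)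
    rw [Real.dist_eq, abs_sub_comm x x']
    simp only [NNReal.coe_natCast]
    linarith
  · intro n x
    show (⨆ y, (F y - n * |x + T - y|)) = _
    rw [← (Equiv.addRight T).iSup_comp]
    simp only [Equiv.coe_addRight, hper _, add_sub_add_right_eq_sub]
  · intro n x
    exact ciSup_le (hle n x)
  · intro x
    rw [Metric.tendsto_atTop]
    intro ε hε
    have h1 := hF x (F x + ε / 2) (by linarith)
    obtain ⟨δ, hδ, h2⟩ := Metric.eventually_nhds_iff.1 h1
    obtain ⟨N, hN⟩ := exists_nat_gt ((M - m) / δ)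
    refine ⟨N, fun n hn => ?_⟩
    have h3 : (⨆ y, (F y - n * |x - y|)) ≤ F x + ε / 2 := by
      apply ciSup_le
      intro y
      have hnn : 0 ≤ (n : ℝ) * |x - y| := by positivity
      rcases lt_or_ge (dist y x) δ with h | h
      · have : F y < F x + ε / 2 := h2 h
        linarith
      · rw [dist_comm, Real.dist_eq] at h
        have h4 : (M - m) < N * δ := by rwa [div_lt_iff₀ hδ] at hN
        have h5 : (N : ℝ) ≤ n := by exact_mod_cast hn
        have h6 : (N : ℝ) * δ ≤ n * |x - y| := by gcongr
        linarith [hM y, hm x]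
    have h4 := hFle n x
    rw [Real.dist_eq, abs_lt]
    constructor <;> linarith

theorem localGlobal {f : ℂ → ℝ} {c : ℂ} {r m : ℝ} (hr : 0 < r)
    (hf : UpperSemicontinuousOn f (closedBall c r)) (hm : ∀ z ∈ closedBall c r, m ≤ f z)
    (hloc : ∀ z ∈ ball c r, ∃ s > 0, closedBall z s ⊆ closedBall c r ∧
      f z ≤ Real.circleAverage f z s) : f c ≤ Real.circleAverage f c r := by
  have hmem : ∀ θ, circleMap c r θ ∈ closedBall c r :=
    fun θ => sphere_subset_closedBall (circleMap_mem_sphere c hr.le θ)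
  have husc : UpperSemicontinuous (fun θ : ℝ => f (circleMap c r θ)) := by
    rw [← upperSemicontinuousOn_univ_iff]
    exact hf.comp (continuous_circleMap c r).continuousOn (fun θ _ => hmem θ)
  obtain ⟨M, hM⟩ := hf.bddAbove_of_isCompact (isCompact_closedBall c r)
  have hM' : ∀ z ∈ closedBall c r, f z ≤ M := fun z hz => hM ⟨z, hz, rfl⟩
  obtain ⟨φ, h1, h2, h3, h4, h5⟩ := usc_approx husc (T := 2 * Real.pi) (m := m) (M := M)
    (fun θ => by simp [periodic_circleMap c r θ]) (fun θ => hm _ (hmem θ)) (fun θ => hM' _ (hmem θ))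
  have hlim : Tendsto (fun n => ∫ θ in (0 : ℝ)..(2 * Real.pi), φ n θ) atTop
      (𝓝 (∫ θ in (0 : ℝ)..(2 * Real.pi), f (circleMap c r θ))) := by
    apply intervalIntegral.tendsto_integral_filter_of_dominated_convergence (fun _ => max |M| |m|)
    · exact Eventually.of_forall fun n => (h1 n).aestronglyMeasurable
    · refine Eventually.of_forall fun n => Eventually.of_forall fun θ _ => ?_
      have e1 := hm _ (hmem θ)
      have e2 := h3 n θ
      have e3 := h4 n θ
      rw [Real.norm_eq_abs, abs_le]
      constructor
      · have := neg_abs_le m; have := le_max_right |M| |m|; linarith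
      · have := le_abs_self M; have := le_max_left |M| |m|; linarith
    · simp
    · exact Eventually.of_forall fun θ _ => h5 θ
  rw [Real.circleAverage_def, smul_eq_mul]
  refine ge_of_tendsto (hlim.const_mul (2 * Real.pi)⁻¹) (Eventually.of_forall fun n => ?_)
  exact le_of_cont hr hf hm hloc (h1 n) (h2 n) (h3 n)

end

section
variable {X : Type*} [NormedAddCommGroup X] [NormedSpace ℂ X]

/-- real valued, locally bounded plurisubharmonic functions -/
structure RSM (f : X → ℝ) (Ω : Set X) : Prop where
  usc : UpperSemicontinuousOn f Ω
  bdd : ∀ K ⊆ Ω, IsCompact K → ∃ m : ℝ, ∀ x ∈ K, m ≤ f x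
  sm : ∀ a b : X, ∀ c : ℂ, ∀ r : ℝ, 0 < r → (∀ l ∈ closedBall c r, a + l • b ∈ Ω) →
    f (a + c • b) ≤ Real.circleAverage (fun l : ℂ => f (a + l • b)) c r

theorem line_cont (a b : X) : Continuous (fun l : ℂ => a + l • b) := by fun_prop

theorem RSM.lineUsc {f : X → ℝ} {Ω : Set X} (hf : RSM f Ω) {a b : X} {c : ℂ} {r : ℝ}
    (h : ∀ l ∈ closedBall c r, a + l • b ∈ Ω) :
    UpperSemicontinuousOn (fun l : ℂ => f (a + l • b)) (closedBall c r) :=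
  hf.usc.comp (line_cont a b).continuousOn h

theorem RSM.lineBdd {f : X → ℝ} {Ω : Set X} (hf : RSM f Ω) {a b : X} {c : ℂ} {r : ℝ}
    (h : ∀ l ∈ closedBall c r, a + l • b ∈ Ω) :
    ∃ m : ℝ, ∀ l ∈ closedBall c r, m ≤ f (a + l • b) := by
  obtain ⟨m, hm⟩ := hf.bdd ((fun l : ℂ => a + l • b) '' closedBall c r)
    (by rintro _ ⟨l, hl, rfl⟩; exact h l hl)
    ((isCompact_closedBall c r).image (line_cont a b))
  exact ⟨m, fun l hl => hm _ ⟨l, hl, rfl⟩⟩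

theorem RSM.circInt {f : X → ℝ} {Ω : Set X} (hf : RSM f Ω) {a b : X} {c : ℂ} {r : ℝ} (hr : 0 < r)
    (h : ∀ l ∈ closedBall c r, a + l • b ∈ Ω) :
    CircleIntegrable (fun l : ℂ => f (a + l • b)) c r := by
  obtain ⟨m, hm⟩ := hf.lineBdd h
  exact circInt_of_usc hr ((hf.lineUsc h).mono sphere_subset_closedBall)
    (fun z hz => hm z (sphere_subset_closedBall hz))

theorem circInt_of {f : X → ℝ} {Ω : Set X} (hu : UpperSemicontinuousOn f Ω)
    (hb : ∀ K ⊆ Ω, IsCompact K → ∃ m : ℝ, ∀ x ∈ K, m ≤ f x) {a b : X} {c : ℂ} {r : ℝ} (hr : 0 < r)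
    (h : ∀ l ∈ closedBall c r, a + l • b ∈ Ω) :
    CircleIntegrable (fun l : ℂ => f (a + l • b)) c r := by
  obtain ⟨m, hm⟩ := hb ((fun l : ℂ => a + l • b) '' closedBall c r)
    (by rintro _ ⟨l, hl, rfl⟩; exact h l hl)
    ((isCompact_closedBall c r).image (line_cont a b))
  exact circInt_of_usc hr ((hu.comp (line_cont a b).continuousOn h).mono sphere_subset_closedBall)
    (fun z hz => hm _ ⟨z, (sphere_subset_closedBall hz), rfl⟩)

theorem avg_mono {f g : ℂ → ℝ} {c : ℂ} {r : ℝ} (hr : 0 < r) (hf : CircleIntegrable f c r)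
    (hg : CircleIntegrable g c r) (h : ∀ l ∈ closedBall c r, f l ≤ g l) :
    Real.circleAverage f c r ≤ Real.circleAverage g c r := by
  apply Real.circleAverage_mono hf hg
  intro x hx
  rw [abs_of_pos hr] at hx
  exact h x (sphere_subset_closedBall hx)

theorem RSM.mono {f : X → ℝ} {Ω Ω' : Set X} (hf : RSM f Ω) (h : Ω' ⊆ Ω) : RSM f Ω' :=
  ⟨hf.usc.mono h, fun K hK hc => hf.bdd K (hK.trans h) hc,
    fun a b c r hr hd => hf.sm a b c r hr (fun l hl => h (hd l hl))⟩

theorem RSM.const (m : ℝ) (Ω : Set X) : RSM (fun _ => m) Ω :=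
  ⟨upperSemicontinuousOn_const, fun _ _ _ => ⟨m, fun _ _ => le_rfl⟩,
    fun a b c r hr _ => (Real.circleAverage_const m c r).ge⟩

theorem RSM.sup {f g : X → ℝ} {Ω : Set X} (hf : RSM f Ω) (hg : RSM g Ω) :
    RSM (fun x => max (f x) (g x)) Ω := by
  have hu : UpperSemicontinuousOn (fun x => max (f x) (g x)) Ω := hf.usc.sup hg.usc
  have hb : ∀ K ⊆ Ω, IsCompact K → ∃ m : ℝ, ∀ x ∈ K, m ≤ max (f x) (g x) := by
    intro K hK hc
    obtain ⟨m, hm⟩ := hf.bdd K hK hc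
    exact ⟨m, fun x hx => (hm x hx).trans (le_max_left _ _)⟩
  refine ⟨hu, hb, fun a b c r hr hd => max_le ?_ ?_⟩
  · exact (hf.sm a b c r hr hd).trans (avg_mono hr (hf.circInt hr hd) (circInt_of hu hb hr hd)
      (fun l _ => le_max_left _ _))
  · exact (hg.sm a b c r hr hd).trans (avg_mono hr (hg.circInt hr hd) (circInt_of hu hb hr hd)
      (fun l _ => le_max_right _ _))

theorem RSM.add {f g : X → ℝ} {Ω : Set X} (hf : RSM f Ω) (hg : RSM g Ω) :
    RSM (fun x => f x + g x) Ω := by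
  refine ⟨hf.usc.add hg.usc, fun K hK hc => ?_, fun a b c r hr hd => ?_⟩
  · obtain ⟨m, hm⟩ := hf.bdd K hK hc
    obtain ⟨m', hm'⟩ := hg.bdd K hK hc
    exact ⟨m + m', fun x hx => add_le_add (hm x hx) (hm' x hx)⟩
  · rw [Real.circleAverage_fun_add (hf.circInt hr hd) (hg.circInt hr hd)]
    exact add_le_add (hf.sm a b c r hr hd) (hg.sm a b c r hr hd)

theorem RSM.const_mul {f : X → ℝ} {Ω : Set X} (hf : RSM f Ω) {α : ℝ} (hα : 0 < α) :
    RSM (fun x => α * f x) Ω := by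
  refine ⟨?_, fun K hK hc => ?_, fun a b c r hr hd => ?_⟩
  · intro x hx y hy
    have h1 : f x < y / α := by rw [lt_div_iff₀ hα]; linarith
    filter_upwards [hf.usc x hx _ h1] with z hz
    rw [lt_div_iff₀ hα] at hz; linarith
  · obtain ⟨m, hm⟩ := hf.bdd K hK hc
    exact ⟨α * m, fun x hx => mul_le_mul_of_nonneg_left (hm x hx) hα.le⟩
  · have := Real.circleAverage_fun_smul (a := α) (f := fun l : ℂ => f (a + l • b)) (c := c) (R := r)
    simp only [smul_eq_mul] at this
    rw [this]
    exact mul_le_mul_of_nonneg_left (hf.sm a b c r hr hd) hα.le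

theorem RSM.sum {f : ℕ → X → ℝ} {Ω : Set X} (hf : ∀ n, RSM (f n) Ω) (N : ℕ) :
    RSM (fun x => ∑ n ∈ Finset.range N, f n x) Ω := by
  induction N with
  | zero => simpa using RSM.const 0 Ω
  | succ N ih => simpa only [Finset.sum_range_succ] using ih.add (hf N)

theorem RSM.supConv [ProperSpace X] {k : X → ℝ} {Ω V : Set X} (hk : RSM k Ω) (hΩ : IsOpen Ω) {δ : ℝ}
    (hδ : 0 < δ) (hV : ∀ x ∈ V, closedBall x δ ⊆ Ω) :
    RSM (fun x => sSup (k '' closedBall x δ)) V := by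
  have hbdd : ∀ x ∈ V, BddAbove (k '' closedBall x δ) := fun x hx =>
    (hk.usc.mono (hV x hx)).bddAbove_of_isCompact (isCompact_closedBall x δ)
  have hmax : ∀ x ∈ V, ∃ t ∈ closedBall x δ, sSup (k '' closedBall x δ) = k t := by
    intro x hx
    obtain ⟨t, ht, hm⟩ := (hk.usc.mono (hV x hx)).exists_isMaxOn ⟨x, mem_closedBall_self hδ.le⟩
      (isCompact_closedBall x δ)
    refine ⟨t, ht, le_antisymm ?_ (le_csSup (hbdd x hx) ⟨t, ht, rfl⟩)⟩
    apply csSup_le ((nonempty_closedBall.2 hδ.le).image k)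
    rintro _ ⟨y, hy, rfl⟩
    exact hm hy
  have hle : ∀ x ∈ V, ∀ t ∈ closedBall x δ, k t ≤ sSup (k '' closedBall x δ) :=
    fun x hx t ht => le_csSup (hbdd x hx) ⟨t, ht, rfl⟩
  have hVΩ : V ⊆ Ω := fun x hx => hV x hx (mem_closedBall_self hδ.le)
  have hu : UpperSemicontinuousOn (fun x => sSup (k '' closedBall x δ)) V := by
    intro x hx y hy
    have h1 : closedBall x δ ⊆ interior {t | k t < y} := by
      intro t ht
      rw [mem_interior_iff_mem_nhds]
      have h2 := hk.usc t (hV x hx ht) y ((hle x hx t ht).trans_lt hy)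
      rwa [hΩ.nhdsWithin_eq (hV x hx ht)] at h2
    obtain ⟨η, hη, h2⟩ := (isCompact_closedBall x δ).exists_thickening_subset_open isOpen_interior h1
    filter_upwards [self_mem_nhdsWithin, mem_nhdsWithin_of_mem_nhds (ball_mem_nhds x hη)] with x' hx' hb
    obtain ⟨t, ht, he⟩ := hmax x' hx'
    rw [he]
    have h3 : t ∈ thickening η (closedBall x δ) := by
      rw [mem_thickening_iff]
      refine ⟨t - x' + x, ?_, ?_⟩
      · rw [mem_closedBall, dist_eq_norm] at ht ⊢
        simpa using ht
      · rw [mem_ball, dist_eq_norm] at hb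
        rw [dist_eq_norm]
        convert hb using 2
        abel
    have h4 : t ∈ {t | k t < y} := interior_subset (h2 h3)
    exact h4
  have hb : ∀ K ⊆ V, IsCompact K → ∃ m : ℝ, ∀ x ∈ K, m ≤ sSup (k '' closedBall x δ) := by
    intro K hK hc
    obtain ⟨m, hm⟩ := hk.bdd K (hK.trans hVΩ) hc
    exact ⟨m, fun x hx => (hm x hx).trans (hle x (hK hx) x (mem_closedBall_self hδ.le))⟩
  refine ⟨hu, hb, fun a b c r hr hd => ?_⟩
  obtain ⟨t, ht, he⟩ := hmax _ (hd c (mem_closedBall_self hr.le))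
  simp only [he]
  obtain ⟨v, rfl⟩ : ∃ v, t = (a + v) + c • b := ⟨t - c • b - a, by abel⟩
  have hv : ∀ l : ℂ, a + v + l • b ∈ closedBall (a + l • b) δ := by
    intro l
    rw [mem_closedBall, dist_eq_norm] at ht ⊢
    convert ht using 2
    abel
  have hd' : ∀ l ∈ closedBall c r, a + v + l • b ∈ Ω := fun l hl => hV _ (hd l hl) (hv l)
  exact (hk.sm (a + v) b c r hr hd').trans (avg_mono hr (hk.circInt hr hd')
    (circInt_of hu hb hr hd) (fun l hl => hle _ (hd l hl) _ (hv l)))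

theorem RSM.glue {ρ H : X → ℝ} {Ω : Set X} (hΩ : IsOpen Ω) (hρ : RSM ρ Ω) (hc : ContinuousOn ρ Ω)
    (j : ℝ) (hH : RSM H {x ∈ Ω | ρ x < j}) (hH0 : ∀ x ∈ Ω, ρ x < j → H x ≤ 0) :
    RSM (fun x => if ρ x < j then max (H x) (2 * ρ x + (1 - 2 * j)) else 2 * ρ x + (1 - 2 * j)) Ω := by
  set R : X → ℝ := fun x => 2 * ρ x + (1 - 2 * j) with hR
  have hRSM : RSM R Ω := (hρ.const_mul two_pos).add (RSM.const _ Ω)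
  have hRc : ContinuousOn R Ω := by fun_prop
  set V := {x ∈ Ω | ρ x < j} with hV
  have hVo : IsOpen V := hc.isOpen_inter_preimage hΩ isOpen_Iio
  set w : X → ℝ := fun x => if ρ x < j then max (H x) (R x) else R x with hw
  have hRw : ∀ x, R x ≤ w x := by
    intro x
    simp only [hw]
    split_ifs
    · exact le_max_right _ _
    · exact le_rfl
  have hHw : ∀ x ∈ V, H x ≤ w x := by
    intro x hx
    simp only [hw, if_pos hx.2]
    exact le_max_left _ _
  have hu : UpperSemicontinuousOn w Ω := by
    intro x hx
    rcases lt_or_ge (ρ x) j with h | h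
    · have h1 : UpperSemicontinuousOn (fun x => max (H x) (R x)) V :=
        hH.usc.sup (hRSM.usc.mono (fun x hx => hx.1))
      intro y hy
      have h3 := h1 x ⟨hx, h⟩ y (by simpa [hw, h] using hy)
      rw [hVo.nhdsWithin_eq ⟨hx, h⟩] at h3
      refine mem_nhdsWithin_of_mem_nhds ?_
      filter_upwards [h3, hVo.mem_nhds ⟨hx, h⟩] with z hz hzV
      simpa [hw, hzV.2] using hz
    · have h2 : ∀ᶠ z in 𝓝[Ω] x, j - 1 / 2 < ρ z :=
        (hc x hx).eventually (lt_mem_nhds (by linarith))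
      intro y hy
      have h3 := hRSM.usc x hx y (by simpa [hw, not_lt.2 h] using hy)
      filter_upwards [h2, self_mem_nhdsWithin, h3] with z hz hzΩ h3z
      have h5 : w z = R z := by
        simp only [hw]
        split_ifs with h4
        · rw [max_eq_right]
          have := hH0 z hzΩ h4
          simp only [hR]; linarith
        · rfl
      rw [h5]
      exact h3z
  have hb : ∀ K ⊆ Ω, IsCompact K → ∃ m : ℝ, ∀ x ∈ K, m ≤ w x := by
    intro K hK hc
    obtain ⟨m, hm⟩ := hRSM.bdd K hK hc
    exact ⟨m, fun x hx => (hm x hx).trans (hRw x)⟩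
  refine ⟨hu, hb, fun a b c r hr hd => ?_⟩
  obtain ⟨m, hm⟩ := hRSM.lineBdd hd
  refine localGlobal (f := fun l => w (a + l • b)) hr (hu.comp (line_cont a b).continuousOn hd)
    (m := m) (fun z hz => (hm z hz).trans (hRw _)) ?_
  intro z hz
  obtain ⟨s₀, hs₀, hs₀b⟩ := Metric.nhds_basis_closedBall.mem_iff.1 (isOpen_ball.mem_nhds hz)
  have hs₀b' := hs₀b.trans ball_subset_closedBall
  by_cases hcase : w (a + z • b) = R (a + z • b)
  · refine ⟨s₀, hs₀, hs₀b', ?_⟩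
    have hd' : ∀ l ∈ closedBall z s₀, a + l • b ∈ Ω := fun l hl => hd l (hs₀b' hl)
    rw [hcase]
    exact (hRSM.sm a b z s₀ hs₀ hd').trans (avg_mono hs₀ (hRSM.circInt hs₀ hd')
      (circInt_of hu hb hs₀ hd') (fun l _ => hRw _))
  · have hlt : ρ (a + z • b) < j := by
      by_contra hn
      exact hcase (by simp only [hw, if_neg hn])
    have hwH : w (a + z • b) = H (a + z • b) := by
      simp only [hw, if_pos hlt] at hcase ⊢
      rcases max_choice (H (a + z • b)) (R (a + z • b)) with h | h
      · exact h
      · exact absurd h hcase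
    have hzV : a + z • b ∈ V := ⟨hd z (ball_subset_closedBall hz), hlt⟩
    obtain ⟨s₁, hs₁, hs₁b⟩ := Metric.nhds_basis_closedBall.mem_iff.1
      ((hVo.preimage (line_cont a b)).mem_nhds hzV)
    have hs : 0 < min s₀ s₁ := lt_min hs₀ hs₁
    have hb0 : closedBall z (min s₀ s₁) ⊆ closedBall c r :=
      (closedBall_subset_closedBall (min_le_left _ _)).trans hs₀b'
    have hb1 : ∀ l ∈ closedBall z (min s₀ s₁), a + l • b ∈ V := fun l hl =>
      hs₁b (closedBall_subset_closedBall (min_le_right _ _) hl)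
    refine ⟨min s₀ s₁, hs, hb0, ?_⟩
    rw [hwH]
    exact (hH.sm a b z _ hs hb1).trans (avg_mono hs (hH.circInt hs hb1)
      (circInt_of hu hb hs (fun l hl => hd l (hb0 hl))) (fun l hl => hHw _ (hb1 l hl)))

end

section
variable {X : Type*} [NormedAddCommGroup X] [NormedSpace ℂ X]

/-- plurisubharmonic functions, possibly identically `⊥` -/
structure ESM (u : X → EReal) (Ω : Set X) : Prop where
  top : ∀ x ∈ Ω, u x ≠ ⊤
  usc : UpperSemicontinuousOn u Ω
  sm : ∀ a b : X, ∀ c : ℂ, ∀ r : ℝ, 0 < r → (∀ l ∈ closedBall c r, a + l • b ∈ Ω) →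
    u (a + c • b) ≤ circleAvg (fun l : ℂ => u (a + l • b)) c r

theorem ESM.trunc {u : X → EReal} {Ω : Set X} (hu : ESM u Ω) (k : ℝ) :
    RSM (fun x => (max (u x) (k : EReal)).toReal) Ω := by
  have hcoe : ∀ x ∈ Ω, (((max (u x) (k : EReal)).toReal : ℝ) : EReal) = max (u x) (k : EReal) := by
    intro x hx
    apply EReal.coe_toReal
    · exact (max_lt (hu.top x hx).lt_top (EReal.coe_lt_top k)).ne
    · exact ((EReal.bot_lt_coe k).trans_le (le_max_right _ _)).ne'
  have hk : ∀ x ∈ Ω, k ≤ (max (u x) (k : EReal)).toReal := by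
    intro x hx
    rw [← EReal.coe_le_coe_iff, hcoe x hx]
    exact le_max_right _ _
  have husc : UpperSemicontinuousOn (fun x => (max (u x) (k : EReal)).toReal) Ω := by
    intro x hx y hy
    have h1 : max (u x) (k : EReal) < (y : EReal) := by
      rw [← hcoe x hx]; exact_mod_cast hy
    have h2 := hu.usc x hx y ((le_max_left _ _).trans_lt h1)
    filter_upwards [h2, self_mem_nhdsWithin] with z hz hzΩ
    rw [← EReal.coe_lt_coe_iff, hcoe z hzΩ]
    exact max_lt hz ((le_max_right _ _).trans_lt h1)
  have hb : ∀ K ⊆ Ω, IsCompact K → ∃ m : ℝ, ∀ x ∈ K, m ≤ (max (u x) (k : EReal)).toReal :=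
    fun K hK _ => ⟨k, fun x hx => hk x (hK hx)⟩
  refine ⟨husc, hb, fun a b c r hr hd => ?_⟩
  have hcint := circInt_of husc hb hr hd
  have hctr := hd c (mem_closedBall_self hr.le)
  rcases le_or_gt (u (a + c • b)) k with h | h
  · rw [max_eq_right h, EReal.toReal_coe]
    refine (Real.circleAverage_const k c r).ge.trans ?_
    exact avg_mono hr (circleIntegrable_const _ _ _) hcint (fun l hl => hk _ (hd l hl))
  · rw [max_eq_left h.le]
    have h1 := hu.sm a b c r hr hd
    unfold circleAvg at h1
    split_ifs at h1 with hcond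
    · obtain ⟨hI, hae⟩ := hcond
      have h2 : (u (a + c • b)).toReal ≤
          (∫ θ in (0:ℝ)..(2 * Real.pi), (u (a + circleMap c r θ • b)).toReal) / (2 * Real.pi) := by
        rw [← EReal.coe_le_coe_iff, EReal.coe_toReal (hu.top _ hctr) ((EReal.bot_lt_coe k).trans h).ne']
        exact h1
      refine h2.trans ?_
      rw [Real.circleAverage_def, smul_eq_mul, div_eq_inv_mul]
      apply mul_le_mul_of_nonneg_left _ (inv_nonneg.2 Real.two_pi_pos.le)
      apply intervalIntegral.integral_mono_ae_restrict Real.two_pi_pos.le hI hcint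
      rw [← restrict_Ioc_eq_restrict_Icc]
      filter_upwards [hae] with θ hθ
      have hm := hd _ (sphere_subset_closedBall (circleMap_mem_sphere c hr.le θ))
      rw [← EReal.coe_le_coe_iff, hcoe _ hm, EReal.coe_toReal (hu.top _ hm) hθ]
      exact le_max_left _ _
    · exact absurd (le_bot_iff.1 h1) ((EReal.bot_lt_coe k).trans h).ne'

theorem localStep [ProperSpace X] {u : X → EReal} {Ω K e : Set X} (hΩ : IsOpen Ω) (hu : ESM u Ω)
    (hK : IsCompact K) (hKΩ : K ⊆ Ω) (he : IsCompact e) (heK : e ⊆ K) (heu : ∀ x ∈ e, u x = ⊥)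
    {p : X} (hp : p ∈ K) (hup : u p ≠ ⊥) {ε : ℝ} (hε : 0 < ε) :
    ∃ H : X → ℝ, RSM H K ∧ (∀ x ∈ K, H x ≤ 0) ∧ (∀ x ∈ e, H x ≤ -1) ∧
      ∃ s ∈ 𝓝 p, ∀ x ∈ s, x ∈ K → -ε ≤ H x := by
  obtain ⟨δ₁, hδ₁, hδ₁s⟩ := hK.exists_cthickening_subset_open hΩ hKΩ
  have hK1 : IsCompact (cthickening δ₁ K) := hK.cthickening
  obtain ⟨q, hq, hqm⟩ := (hu.usc.mono hδ₁s).exists_isMaxOn ⟨p, self_subset_cthickening K hp⟩ hK1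
  have hqm' : ∀ x ∈ cthickening δ₁ K, u x ≤ u q := fun x hx => hqm hx
  obtain ⟨M, hM⟩ : ∃ M : ℝ, ∀ x ∈ cthickening δ₁ K, u x ≤ M := by
    refine ⟨(u q).toReal, fun x hx => (hqm' x hx).trans ?_⟩
    exact EReal.le_coe_toReal (hu.top q (hδ₁s hq))
  have hpΩ := hKΩ hp
  have hpc : (((u p).toReal : ℝ) : EReal) = u p := EReal.coe_toReal (hu.top p hpΩ) hup
  have hpM : (u p).toReal ≤ M := by
    rw [← EReal.coe_le_coe_iff, hpc]; exact hM p (self_subset_cthickening K hp)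
  set N : ℝ := (M - (u p).toReal) / ε + 1 with hN
  have hNpos : 0 < N := by
    have : 0 ≤ (M - (u p).toReal) / ε := div_nonneg (by linarith) hε.le
    linarith
  set k : X → ℝ := fun x => N⁻¹ * ((max (u x) ((M - N : ℝ) : EReal)).toReal + -M) with hk
  have hkR : RSM k Ω := ((hu.trunc (M - N)).add (RSM.const (-M) Ω)).const_mul (inv_pos.2 hNpos)
  have hk0 : ∀ x ∈ cthickening δ₁ K, k x ≤ 0 := by
    intro x hx
    have h1 : max (u x) ((M - N : ℝ) : EReal) ≤ M := max_le (hM x hx) (by exact_mod_cast (by linarith))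
    have h2 : (max (u x) ((M - N : ℝ) : EReal)).toReal ≤ M := by
      have := EReal.toReal_le_toReal h1
        ((EReal.bot_lt_coe _).trans_le (le_max_right _ _)).ne' (EReal.coe_ne_top M)
      simpa using this
    apply mul_nonpos_of_nonneg_of_nonpos (inv_nonneg.2 hNpos.le)
    linarith
  have hk1 : ∀ x, u x < ((M - N : ℝ) : EReal) → k x = -1 := by
    intro x hx
    simp only [hk]
    rw [max_eq_right hx.le, EReal.toReal_coe]
    field_simp
    ring
  have hkp : -ε ≤ k p := by
    have h1 : (u p).toReal ≤ (max (u p) ((M - N : ℝ) : EReal)).toReal := by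
      apply EReal.toReal_le_toReal (le_max_left _ _) hup
      exact (max_lt (hu.top p hpΩ).lt_top (EReal.coe_lt_top _)).ne
    simp only [hk]
    rw [← div_eq_inv_mul, le_div_iff₀ hNpos]
    have h2 : ε * N = M - (u p).toReal + ε := by
      simp only [hN]; field_simp
    nlinarith
  have hO : e ⊆ interior {x | u x < ((M - N : ℝ) : EReal)} := by
    intro x hx
    rw [mem_interior_iff_mem_nhds]
    have hxΩ := hKΩ (heK hx)
    have h2 := hu.usc x hxΩ ((M - N : ℝ) : EReal) ((heu x hx).trans_lt (EReal.bot_lt_coe _))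
    rwa [hΩ.nhdsWithin_eq hxΩ] at h2
  obtain ⟨δ₂, hδ₂, hδ₂s⟩ := he.exists_cthickening_subset_open isOpen_interior hO
  set δ := min δ₁ δ₂ with hδ
  have hδp : 0 < δ := lt_min hδ₁ hδ₂
  have hball : ∀ x ∈ K, closedBall x δ ⊆ cthickening δ₁ K := fun x hx =>
    (closedBall_subset_closedBall (min_le_left _ _)).trans (closedBall_subset_cthickening hx δ₁)
  have hbe : ∀ x ∈ e, closedBall x δ ⊆ cthickening δ₂ e := fun x hx =>
    (closedBall_subset_closedBall (min_le_right _ _)).trans (closedBall_subset_cthickening hx δ₂)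
  refine ⟨_, hkR.supConv hΩ hδp (fun x hx => (hball x hx).trans hδ₁s), ?_, ?_,
    ball p δ, ball_mem_nhds p hδp, ?_⟩
  · intro x hx
    apply csSup_le ((nonempty_closedBall.2 hδp.le).image k)
    rintro _ ⟨y, hy, rfl⟩
    exact hk0 y (hball x hx hy)
  · intro x hx
    apply csSup_le ((nonempty_closedBall.2 hδp.le).image k)
    rintro _ ⟨y, hy, rfl⟩
    have h4 : y ∈ {x | u x < ((M - N : ℝ) : EReal)} := interior_subset (hδ₂s (hbe x hx hy))
    exact (hk1 y h4).le
  · intro x hx hxK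
    refine hkp.trans (le_csSup ⟨0, ?_⟩ ⟨p, ?_, rfl⟩)
    · rintro _ ⟨y, hy, rfl⟩
      exact hk0 y (hball x hxK hy)
    · rw [mem_closedBall, dist_comm]
      exact (mem_ball.1 hx).le

theorem compactStep [ProperSpace X] {u : X → EReal} {Ω K e C : Set X} (hΩ : IsOpen Ω) (hu : ESM u Ω)
    (hK : IsCompact K) (hKΩ : K ⊆ Ω) (he : IsCompact e) (heK : e ⊆ K) (heu : ∀ x ∈ e, u x = ⊥)
    (hC : IsCompact C) (hCK : C ⊆ K) (hCu : ∀ x ∈ C, u x ≠ ⊥) {ε : ℝ} (hε : 0 < ε) :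
    ∃ H : X → ℝ, RSM H K ∧ (∀ x ∈ K, H x ≤ 0) ∧ (∀ x ∈ e, H x ≤ -1) ∧
      ∀ x ∈ C, -ε ≤ H x := by
  have key : ∃ H : X → ℝ, RSM H K ∧ (∀ x ∈ K, H x ≤ 0) ∧ (∀ x ∈ e, H x ≤ -1) ∧
      ∀ x ∈ C, x ∈ K → -ε ≤ H x := by
    refine hC.induction_on (p := fun S => ∃ H : X → ℝ, RSM H K ∧ (∀ x ∈ K, H x ≤ 0) ∧
      (∀ x ∈ e, H x ≤ -1) ∧ ∀ x ∈ S, x ∈ K → -ε ≤ H x) ?_ ?_ ?_ ?_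
    · exact ⟨fun _ => -1, RSM.const _ _, by norm_num, by norm_num, by simp⟩
    · rintro s t hst ⟨H, h1, h2, h3, h4⟩
      exact ⟨H, h1, h2, h3, fun x hx => h4 x (hst hx)⟩
    · rintro s t ⟨H, h1, h2, h3, h4⟩ ⟨H', h1', h2', h3', h4'⟩
      refine ⟨fun x => max (H x) (H' x), h1.sup h1', fun x hx => max_le (h2 x hx) (h2' x hx),
        fun x hx => max_le (h3 x hx) (h3' x hx), ?_⟩
      rintro x (hx | hx) hxK
      · exact (h4 x hx hxK).trans (le_max_left _ _)
      · exact (h4' x hx hxK).trans (le_max_right _ _)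
    · intro p hp
      obtain ⟨H, h1, h2, h3, s, hs, h4⟩ := localStep hΩ hu hK hKΩ he heK heu (hCK hp) (hCu p hp) hε
      exact ⟨s, mem_nhdsWithin_of_mem_nhds hs, H, h1, h2, h3, h4⟩
  obtain ⟨H, h1, h2, h3, h4⟩ := key
  exact ⟨H, h1, h2, h3, fun x hx => h4 x hx (hCK hx)⟩

theorem mct {α : Type*} [MeasurableSpace α] {μ : Measure α} {g : ℕ → α → ℝ}
    (hi : ∀ n, Integrable (g n) μ) (ha : ∀ x, Antitone (fun n => g n x)) {T : ℝ}
    (hT : ∀ n, T ≤ ∫ x, g n x ∂μ) :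
    Integrable (fun x => (⨅ n, (g n x : EReal)).toReal) μ ∧
    (∀ᵐ x ∂μ, (⨅ n, (g n x : EReal)) ≠ ⊥) ∧ T ≤ ∫ x, (⨅ n, (g n x : EReal)).toReal ∂μ := by
  set f : α → ENNReal := fun x => ⨆ n, ENNReal.ofReal (g 0 x - g n x) with hf
  have hmeas : ∀ n, AEMeasurable (fun x => ENNReal.ofReal (g 0 x - g n x)) μ := fun n =>
    ((hi 0).sub (hi n)).aemeasurable.ennreal_ofReal
  have hfm : AEMeasurable f μ := AEMeasurable.iSup hmeas
  have hle0 : ∀ n x, g n x ≤ g 0 x := fun n x => ha x (Nat.zero_le n)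
  have hT0 : T ≤ ∫ x, g 0 x ∂μ := hT 0
  have hlin : ∫⁻ x, f x ∂μ ≤ ENNReal.ofReal ((∫ x, g 0 x ∂μ) - T) := by
    rw [lintegral_iSup' hmeas (Eventually.of_forall fun x n k hnk =>
      ENNReal.ofReal_le_ofReal (by have := ha x hnk; simp only at this; linarith))]
    apply iSup_le
    intro n
    rw [← ofReal_integral_eq_lintegral_ofReal (f := fun x => g 0 x - g n x) ((hi 0).sub (hi n))
      (Eventually.of_forall fun x => sub_nonneg.2 (hle0 n x))]
    apply ENNReal.ofReal_le_ofReal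
    have : ∫ x, (g 0 x - g n x) ∂μ = (∫ x, g 0 x ∂μ) - ∫ x, g n x ∂μ := integral_sub (hi 0) (hi n)
    rw [this]
    linarith [hT n]
  have hlt : ∫⁻ x, f x ∂μ ≠ ⊤ := (hlin.trans_lt ENNReal.ofReal_lt_top).ne
  have hae : ∀ᵐ x ∂μ, f x < ⊤ := ae_lt_top' hfm hlt
  have hG : ∀ x, f x < ⊤ → (⨅ n, (g n x : EReal)) = ((g 0 x - (f x).toReal : ℝ) : EReal) := by
    intro x hx
    apply le_antisymm
    · by_contra! hcon
      obtain ⟨y, hy1, hy2⟩ := EReal.lt_iff_exists_real_btwn.1 hcon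
      have hy3 : ∀ n, y < g n x := fun n => by
        exact_mod_cast hy2.trans_le (iInf_le _ n)
      have h1 : f x ≤ ENNReal.ofReal (g 0 x - y) :=
        iSup_le fun n => ENNReal.ofReal_le_ofReal (by linarith [hy3 n])
      have h2 := ENNReal.toReal_mono ENNReal.ofReal_ne_top h1
      rw [ENNReal.toReal_ofReal (by linarith [hy3 0])] at h2
      rw [EReal.coe_lt_coe_iff] at hy1
      linarith
    · apply le_iInf
      intro n
      rw [EReal.coe_le_coe_iff]
      have h1 : ENNReal.ofReal (g 0 x - g n x) ≤ f x := le_iSup (fun n => ENNReal.ofReal (g 0 x - g n x)) n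
      have h2 := ENNReal.toReal_mono hx.ne h1
      rw [ENNReal.toReal_ofReal (by linarith [hle0 n x])] at h2
      linarith
  have hEq : (fun x => (⨅ n, (g n x : EReal)).toReal) =ᵐ[μ] fun x => g 0 x - (f x).toReal := by
    filter_upwards [hae] with x hx
    rw [hG x hx, EReal.toReal_coe]
  have hfi : Integrable (fun x => (f x).toReal) μ := integrable_toReal_of_lintegral_ne_top hfm hlt
  refine ⟨((hi 0).sub hfi).congr hEq.symm, ?_, ?_⟩
  · filter_upwards [hae] with x hx
    rw [hG x hx]
    exact EReal.coe_ne_bot _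
  · rw [integral_congr_ae hEq, integral_sub (hi 0) hfi, integral_toReal hfm hae]
    have h2 := ENNReal.toReal_mono ENNReal.ofReal_ne_top hlin
    rw [ENNReal.toReal_ofReal (by linarith)] at h2
    linarith

theorem series {w : ℕ → X → ℝ} {ρ : X → ℝ} {Ω : Set X} (hw : ∀ n, RSM (w n) Ω)
    (hρ : ContinuousOn ρ Ω) (hneg : ∀ (j : ℕ), ∀ x ∈ Ω, ρ x ≤ j → w j x ≤ 0) :
    ∃ W : X → EReal, ESM W Ω ∧
      (∀ x ∈ Ω, Tendsto (fun N => ∑ n ∈ Finset.range N, w n x) atTop atBot → W x = ⊥) ∧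
      (∀ x ∈ Ω, (∃ t : ℝ, ∀ᶠ N in atTop, t ≤ ∑ n ∈ Finset.range N, w n x) → W x ≠ ⊥) := by
  set S : ℕ → X → ℝ := fun N x => ∑ n ∈ Finset.range N, w n x with hS
  have hSR : ∀ N, RSM (S N) Ω := RSM.sum hw
  have hanti : ∀ x ∈ Ω, ∀ m : ℕ, ρ x ≤ m → Antitone (fun n => S (n + m) x) := by
    intro x hx m hm
    apply antitone_nat_of_succ_le
    intro n
    simp only [hS]
    rw [show n + 1 + m = (n + m) + 1 by ring, Finset.sum_range_succ]
    have := hneg (n + m) x hx (hm.trans (by push_cast; linarith [Nat.cast_nonneg (α := ℝ) n]))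
    linarith
  set W : X → EReal := fun x => ⨅ n : ℕ, (S (n + ⌈ρ x⌉₊) x : EReal) with hWdef
  have hW : ∀ x ∈ Ω, ∀ m : ℕ, ρ x ≤ m → W x = ⨅ n : ℕ, (S (n + m) x : EReal) := by
    intro x hx m hm
    have h1 : ⌈ρ x⌉₊ ≤ m := Nat.ceil_le.2 hm
    obtain ⟨k, rfl⟩ := Nat.exists_eq_add_of_le h1
    have h2 : Antitone (fun n => (S (n + ⌈ρ x⌉₊) x : EReal)) := fun a b hab => by
      exact EReal.coe_le_coe_iff.2 (hanti x hx _ (Nat.le_ceil _) hab)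
    have h3 := h2.iInf_nat_add k
    simp only [hWdef]
    rw [← h3]
    congr 1
    ext n
    rw [show n + k + ⌈ρ x⌉₊ = n + (⌈ρ x⌉₊ + k) by ring]
  have hWt : ∀ x, W x ≠ ⊤ := by
    intro x
    have h1 : W x ≤ (S (0 + ⌈ρ x⌉₊) x : EReal) := iInf_le (fun n : ℕ => (S (n + ⌈ρ x⌉₊) x : EReal)) 0
    exact (h1.trans_lt (EReal.coe_lt_top _)).ne
  refine ⟨W, ⟨?_, ?_, ?_⟩, ?_, ?_⟩
  · exact fun x _ => hWt x
  · intro x hx y hy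
    obtain ⟨m, hm⟩ := exists_nat_gt (ρ x)
    have hev : ∀ᶠ z in 𝓝[Ω] x, ρ z < m := (hρ x hx).eventually (gt_mem_nhds hm)
    rw [hW x hx m hm.le, iInf_lt_iff] at hy
    obtain ⟨n, hn⟩ := hy
    obtain ⟨t, ht1, ht2⟩ := EReal.lt_iff_exists_real_btwn.1 hn
    have h1 := (hSR (n + m)).usc x hx t (by exact_mod_cast ht1)
    filter_upwards [hev, self_mem_nhdsWithin, h1] with z hz hzΩ hzt
    rw [hW z hzΩ m hz.le]
    refine (iInf_le _ n).trans_lt (lt_trans ?_ ht2)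
    exact_mod_cast hzt
  · intro a b c r hr hd
    by_cases hbot : W (a + c • b) = ⊥
    · rw [hbot]; exact bot_le
    obtain ⟨B, hB⟩ := (isCompact_closedBall c r).bddAbove_image
      (hρ.comp (line_cont a b).continuousOn hd)
    obtain ⟨m, hm⟩ := exists_nat_gt B
    have hρm : ∀ l ∈ closedBall c r, ρ (a + l • b) ≤ m := fun l hl => (hB ⟨l, hl, rfl⟩).trans hm.le
    have hcm := mem_closedBall_self (x := c) hr.le
    have htop : W (a + c • b) ≠ ⊤ := hWt _
    obtain ⟨t, ht⟩ : ∃ t : ℝ, W (a + c • b) = t := ⟨_, (EReal.coe_toReal htop hbot).symm⟩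
    have hcirc : ∀ θ, circleMap c r θ ∈ closedBall c r :=
      fun θ => sphere_subset_closedBall (circleMap_mem_sphere c hr.le θ)
    have hcint : ∀ n, IntervalIntegrable (fun θ => S (n + m) (a + circleMap c r θ • b)) volume 0
        (2 * Real.pi) := fun n => (hSR (n + m)).circInt hr hd
    have hmct := mct (μ := volume.restrict (Ioc (0:ℝ) (2 * Real.pi)))
      (g := fun n θ => S (n + m) (a + circleMap c r θ • b)) (T := 2 * Real.pi * t)
      (fun n => (intervalIntegrable_iff_integrableOn_Ioc_of_le Real.two_pi_pos.le).1 (hcint n))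
      (fun θ => hanti _ (hd _ (hcirc θ)) m (hρm _ (hcirc θ)))
      (fun n => by
        have h1 := (hSR (n + m)).sm a b c r hr hd
        have h2 : t ≤ S (n + m) (a + c • b) := by
          rw [← EReal.coe_le_coe_iff, ← ht, hW _ (hd c hcm) m (hρm c hcm)]
          exact iInf_le _ n
        have h3 := h2.trans h1
        rw [Real.circleAverage_def, smul_eq_mul, ← div_eq_inv_mul, le_div_iff₀ Real.two_pi_pos,
          intervalIntegral.integral_of_le Real.two_pi_pos.le] at h3
        linarith)
    have hWe : ∀ θ, (⨅ n : ℕ, (S (n + m) (a + circleMap c r θ • b) : EReal)) =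
        W (a + circleMap c r θ • b) := fun θ => (hW _ (hd _ (hcirc θ)) m (hρm _ (hcirc θ))).symm
    simp only [hWe] at hmct
    obtain ⟨e1, e2, e3⟩ := hmct
    unfold circleAvg
    rw [if_pos ⟨(intervalIntegrable_iff_integrableOn_Ioc_of_le Real.two_pi_pos.le).2 e1, e2⟩, ht,
      EReal.coe_le_coe_iff, le_div_iff₀ Real.two_pi_pos,
      intervalIntegral.integral_of_le Real.two_pi_pos.le]
    linarith
  · intro x hx ht
    rw [hW x hx _ (Nat.le_ceil _), eq_bot_iff]
    by_contra! hcon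
    obtain ⟨y, hy1, hy2⟩ := EReal.lt_iff_exists_real_btwn.1 hcon
    obtain ⟨n, hn⟩ := (((tendsto_add_atTop_iff_nat ⌈ρ x⌉₊).2 ht).eventually (eventually_lt_atBot y)).exists
    have h1 : (y : EReal) < S (n + ⌈ρ x⌉₊) x := hy2.trans_le (iInf_le _ n)
    rw [EReal.coe_lt_coe_iff] at h1
    exact lt_asymm h1 hn
  · rintro x hx ⟨t, ht⟩
    obtain ⟨N, hN⟩ := eventually_atTop.1 ht
    have hm : ρ x ≤ ((⌈ρ x⌉₊ + N : ℕ) : ℝ) := (Nat.le_ceil _).trans (by push_cast; linarith [Nat.cast_nonneg (α := ℝ) N])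
    rw [hW x hx _ hm]
    refine ((EReal.bot_lt_coe t).trans_le (le_iInf fun n => ?_)).ne'
    rw [EReal.coe_le_coe_iff]
    exact hN _ (by omega)

end

section
theorem circleAvg_congr {f g : ℂ → EReal} {c : ℂ} {r : ℝ} (hr : 0 < r)
    (h : ∀ l ∈ closedBall c r, f l = g l) : circleAvg f c r = circleAvg g c r := by
  have h1 : ∀ θ, f (circleMap c r θ) = g (circleMap c r θ) := fun θ =>
    h _ (sphere_subset_closedBall (circleMap_mem_sphere c hr.le θ))
  unfold circleAvg
  classical
  exact if_congr (by simp only [h1]) (by simp only [h1]) rfl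

theorem components {G : Set ℂ} {E : Set (ℂ × ℂ)}
    (h : ∀ D : Set ℂ, IsOpen D → IsConnected D → IsCompact (closure D) → closure D ⊆ G →
        CompletePluripolarIn (E ∩ (D ×ˢ (Set.univ : Set ℂ)))
          (D ×ˢ (Set.univ : Set ℂ)))
    {U : Set ℂ} (hU : IsOpen U) (hUc : IsCompact (closure U)) (hUG : closure U ⊆ G) :
    ∃ u : ℂ × ℂ → EReal, ESM u (U ×ˢ (univ : Set ℂ)) ∧
      ∀ x ∈ U ×ˢ (univ : Set ℂ), (u x = ⊥ ↔ x ∈ E) := by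
  have key : ∀ z : ℂ, ∃ u : ℂ × ℂ → EReal, z ∈ U →
      (PSHOn u (connectedComponentIn U z ×ˢ (univ : Set ℂ)) ∧
      ∀ x ∈ connectedComponentIn U z ×ˢ (univ : Set ℂ),
        (u x = ⊥ ↔ x ∈ E ∩ (connectedComponentIn U z ×ˢ (univ : Set ℂ)))) := by
    intro z
    by_cases hz : z ∈ U
    · have hcl : closure (connectedComponentIn U z) ⊆ closure U :=
        closure_mono (connectedComponentIn_subset U z)
      obtain ⟨u, hu⟩ := h (connectedComponentIn U z) hU.connectedComponentIn
        (isConnected_connectedComponentIn_iff.2 hz)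
        (hUc.of_isClosed_subset isClosed_closure hcl) (hcl.trans hUG)
      exact ⟨u, fun _ => hu⟩
    · exact ⟨fun _ => ⊥, fun h => absurd h hz⟩
  choose v0 hv0 using key
  -- choose a representative of each component
  let rep : Set ℂ → ℂ := fun C => by
    classical
    exact if h : ∃ z ∈ U, connectedComponentIn U z = C then h.choose else 0
  have hrep : ∀ z ∈ U, rep (connectedComponentIn U z) ∈ U ∧
      connectedComponentIn U (rep (connectedComponentIn U z)) = connectedComponentIn U z := by
    intro z hz
    have hex : ∃ z' ∈ U, connectedComponentIn U z' = connectedComponentIn U z := ⟨z, hz, rfl⟩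
    have : rep (connectedComponentIn U z) = hex.choose := dif_pos hex
    rw [this]
    exact hex.choose_spec
  let v : Set ℂ → ℂ × ℂ → EReal := fun C => v0 (rep C)
  have hv : ∀ z ∈ U, PSHOn (v (connectedComponentIn U z))
      (connectedComponentIn U z ×ˢ (univ : Set ℂ)) ∧
      ∀ x ∈ connectedComponentIn U z ×ˢ (univ : Set ℂ),
        (v (connectedComponentIn U z) x = ⊥ ↔
          x ∈ E ∩ (connectedComponentIn U z ×ˢ (univ : Set ℂ))) := by
    intro z hz
    have := hv0 (rep (connectedComponentIn U z)) (hrep z hz).1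
    rw [(hrep z hz).2] at this
    exact this
  have hself : ∀ z ∈ U, z ∈ connectedComponentIn U z := fun z hz => mem_connectedComponentIn hz
  refine ⟨fun x => v (connectedComponentIn U x.1) x, ⟨?_, ?_, ?_⟩, ?_⟩
  · rintro x ⟨hx, -⟩
    exact (hv x.1 hx).1.1 x ⟨hself _ hx, mem_univ _⟩
  · rintro x ⟨hx, -⟩ y hy
    have h1 := (hv x.1 hx).1.2.1 x ⟨hself _ hx, mem_univ _⟩ y hy
    have hop : IsOpen (connectedComponentIn U x.1 ×ˢ (univ : Set ℂ)) :=
      hU.connectedComponentIn.prod isOpen_univ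
    have hxm : x ∈ connectedComponentIn U x.1 ×ˢ (univ : Set ℂ) := ⟨hself _ hx, mem_univ _⟩
    rw [hop.nhdsWithin_eq hxm] at h1
    apply mem_nhdsWithin_of_mem_nhds
    filter_upwards [h1, hop.mem_nhds hxm] with t ht htm
    have : connectedComponentIn U x.1 = connectedComponentIn U t.1 := connectedComponentIn_eq htm.1
    show v (connectedComponentIn U t.1) t < y
    rw [← this]
    exact ht
  · intro a b c r hr hd
    have hc := hd c (mem_closedBall_self hr.le)
    set z := (a + c • b).1 with hz
    have hconn : ∀ l ∈ closedBall c r, (a + l • b).1 ∈ connectedComponentIn U z := by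
      have hpre : IsPreconnected ((fun l : ℂ => (a + l • b).1) '' closedBall c r) :=
        (convex_closedBall c r).isPreconnected.image _
          (continuous_fst.comp (line_cont a b)).continuousOn
      have := hpre.subset_connectedComponentIn (x := z) (F := U)
        ⟨c, mem_closedBall_self hr.le, rfl⟩ (by rintro _ ⟨l, hl, rfl⟩; exact (hd l hl).1)
      intro l hl
      exact this ⟨l, hl, rfl⟩
    have h1 := (hv z hc.1).1.2.2.2 a b c r hr (fun l hl => ⟨hconn l hl, mem_univ _⟩)
    refine h1.trans_eq (circleAvg_congr hr fun l hl => ?_)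
    have : connectedComponentIn U z = connectedComponentIn U (a + l • b).1 :=
      connectedComponentIn_eq (hconn l hl)
    show _ = v (connectedComponentIn U (a + l • b).1) _
    rw [← this]
  · rintro x ⟨hx, -⟩
    have hxm : x ∈ connectedComponentIn U x.1 ×ˢ (univ : Set ℂ) := ⟨hself _ hx, mem_univ _⟩
    refine ((hv x.1 hx).2 x hxm).trans ⟨fun h => h.1, fun h => ⟨h, hxm⟩⟩

theorem submean_norm {F : Type*} [NormedAddCommGroup F] [NormedSpace ℂ F] [CompleteSpace F]
    {f : ℂ → F} {c : ℂ} {r : ℝ} (hr : 0 < r) (hf : DifferentiableOn ℂ f (closedBall c r)) :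
    ‖f c‖ ≤ Real.circleAverage (fun l => ‖f l‖) c r := by
  have h1 : Real.circleAverage f c r = f c := by
    apply DiffContOnCl.circleAverage
    rw [abs_of_pos hr]
    apply DifferentiableOn.diffContOnCl
    rwa [closure_ball c hr.ne']
  rw [← h1, Real.circleAverage_def, Real.circleAverage_def, norm_smul, smul_eq_mul,
    Real.norm_of_nonneg (inv_nonneg.2 Real.two_pi_pos.le)]
  apply mul_le_mul_of_nonneg_left _ (inv_nonneg.2 Real.two_pi_pos.le)
  exact intervalIntegral.norm_integral_le_integral_norm Real.two_pi_pos.le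

theorem RSM.norm (Ω : Set (ℂ × ℂ)) : RSM (fun x : ℂ × ℂ => ‖x‖) Ω := by
  refine ⟨continuous_norm.upperSemicontinuous.upperSemicontinuousOn _,
    fun K _ _ => ⟨0, fun x _ => norm_nonneg x⟩, fun a b c r hr _ => ?_⟩
  apply submean_norm (f := fun l : ℂ => a + l • b) hr
  fun_prop

theorem RSM.invDist {G : Set ℂ} (hG : IsOpen G) (hne : Gᶜ.Nonempty) :
    RSM (fun x : ℂ × ℂ => (infDist x.1 Gᶜ)⁻¹) (G ×ˢ (univ : Set ℂ)) ∧
    ContinuousOn (fun x : ℂ × ℂ => (infDist x.1 Gᶜ)⁻¹) (G ×ˢ (univ : Set ℂ)) := by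
  have hpos : ∀ z ∈ G, 0 < infDist z Gᶜ := fun z hz =>
    (hG.isClosed_compl.notMem_iff_infDist_pos hne).1 (fun h => h hz)
  have hcont : ContinuousOn (fun x : ℂ × ℂ => (infDist x.1 Gᶜ)⁻¹) (G ×ˢ (univ : Set ℂ)) :=
    ContinuousOn.inv₀ ((continuous_infDist_pt _).comp continuous_fst).continuousOn
      (fun x hx => (hpos _ hx.1).ne')
  have hb : ∀ K ⊆ G ×ˢ (univ : Set ℂ), IsCompact K →
      ∃ m : ℝ, ∀ x ∈ K, m ≤ (fun x : ℂ × ℂ => (infDist x.1 Gᶜ)⁻¹) x :=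
    fun K _ _ => ⟨0, fun x _ => inv_nonneg.2 infDist_nonneg⟩
  refine ⟨⟨hcont.upperSemicontinuousOn, hb, fun a b c r hr hd => ?_⟩, hcont⟩
  have hcint := circInt_of hcont.upperSemicontinuousOn hb hr hd
  obtain ⟨p, hp, hpd⟩ := hG.isClosed_compl.exists_infDist_eq_dist hne (a + c • b).1
  have hnz : ∀ l ∈ closedBall c r, (a + l • b).1 - p ≠ 0 := by
    intro l hl h0
    exact hp ((sub_eq_zero.1 h0) ▸ (hd l hl).1)
  have hdiff : DifferentiableOn ℂ (fun l : ℂ => ((a + l • b).1 - p)⁻¹) (closedBall c r) := by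
    apply DifferentiableOn.inv _ hnz
    simp only [Prod.fst_add, Prod.smul_fst]
    fun_prop
  have h1 := submean_norm hr hdiff
  have h2 : (infDist (a + c • b).1 Gᶜ)⁻¹ = ‖((a + c • b).1 - p)⁻¹‖ := by
    rw [hpd, norm_inv, dist_eq_norm]
  show (infDist (a + c • b).1 Gᶜ)⁻¹ ≤ _
  rw [h2]
  refine h1.trans (avg_mono hr ?_ hcint ?_)
  · apply ContinuousOn.circleIntegrable hr.le
    exact (hdiff.continuousOn.mono sphere_subset_closedBall).norm
  · intro l hl
    rw [norm_inv, ← dist_eq_norm]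
    exact inv_anti₀ (hpos _ (hd l hl).1) (infDist_le_dist_of_mem hp)

theorem exhaustion {G : Set ℂ} (hG : IsOpen G) :
    ∃ ρ : ℂ × ℂ → ℝ, ContinuousOn ρ (G ×ˢ (univ : Set ℂ)) ∧ RSM ρ (G ×ˢ (univ : Set ℂ)) ∧
      ∀ j : ℝ, IsCompact {x ∈ G ×ˢ (univ : Set ℂ) | ρ x ≤ j} := by
  rcases (Gᶜ).eq_empty_or_nonempty with h | hne
  · refine ⟨fun x => ‖x‖, continuous_norm.continuousOn, RSM.norm _, fun j => ?_⟩
    have hGu : G = univ := compl_empty_iff.1 h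
    have : {x ∈ G ×ˢ (univ : Set ℂ) | ‖x‖ ≤ j} = closedBall 0 j := by
      ext x; simp [hGu]
    rw [this]
    exact isCompact_closedBall _ _
  · obtain ⟨h1, h2⟩ := RSM.invDist hG hne
    refine ⟨fun x => max ‖x‖ (infDist x.1 Gᶜ)⁻¹, ContinuousOn.sup continuous_norm.continuousOn h2,
      (RSM.norm _).sup h1, fun j => ?_⟩
    have hpos : ∀ z ∈ G, 0 < infDist z Gᶜ := fun z hz =>
      (hG.isClosed_compl.notMem_iff_infDist_pos hne).1 (fun h => h hz)
    rcases le_or_gt j 0 with hj | hj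
    · convert isCompact_empty
      ext x
      simp only [mem_ofPred_eq, mem_empty_iff_false, iff_false, not_and, not_le]
      intro hx
      exact hj.trans_lt ((inv_pos.2 (hpos _ hx.1)).trans_le (le_max_right _ _))
    have : {x ∈ G ×ˢ (univ : Set ℂ) | max ‖x‖ (infDist x.1 Gᶜ)⁻¹ ≤ j} =
        closedBall 0 j ∩ {x | j⁻¹ ≤ infDist x.1 Gᶜ} := by
      ext x
      simp only [mem_ofPred_eq, mem_inter_iff, mem_closedBall, dist_zero_right, max_le_iff]
      constructor
      · rintro ⟨hx, h3, h4⟩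
        exact ⟨h3, inv_le_of_inv_le₀ (hpos _ hx.1) h4⟩
      · rintro ⟨h3, h4⟩
        have hp : 0 < infDist x.1 Gᶜ := (inv_pos.2 hj).trans_le h4
        refine ⟨⟨?_, mem_univ _⟩, h3, inv_le_of_inv_le₀ hj h4⟩
        by_contra hx
        exact hp.ne' (infDist_zero_of_mem hx)
    rw [this]
    exact (isCompact_closedBall _ _).inter_right
      (isClosed_le continuous_const ((continuous_infDist_pt _).comp continuous_fst))

end

section
theorem sums_atBot {w : ℕ → ℝ} (h : ∀ᶠ n in atTop, w n ≤ -1) :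
    Tendsto (fun N => ∑ n ∈ Finset.range N, w n) atTop atBot := by
  obtain ⟨N0, hN0⟩ := eventually_atTop.1 h
  have h1 : ∀ N ≥ N0, ∑ n ∈ Finset.range N, w n ≤
      (∑ n ∈ Finset.range N0, w n + N0) + -(N : ℝ) := by
    intro N hN
    induction N, hN using Nat.le_induction with
    | base => linarith
    | succ N hN ih =>
      rw [Finset.sum_range_succ]
      have := hN0 N hN
      push_cast
      linarith
  refine tendsto_atBot_mono' atTop (eventually_atTop.2 ⟨N0, h1⟩) ?_
  exact tendsto_atBot_add_const_left _ _
    (tendsto_neg_atTop_atBot.comp tendsto_natCast_atTop_atTop)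

theorem sums_bddBelow {w : ℕ → ℝ} (h : ∀ᶠ n in atTop, -(1 / 2 : ℝ) ^ n ≤ w n) :
    ∃ t : ℝ, ∀ᶠ N in atTop, t ≤ ∑ n ∈ Finset.range N, w n := by
  obtain ⟨N0, hN0⟩ := eventually_atTop.1 h
  refine ⟨∑ n ∈ Finset.range N0, w n - 2, eventually_atTop.2 ⟨N0, fun N hN => ?_⟩⟩
  have h1 : ∑ n ∈ Finset.range N0, w n - ∑ n ∈ Finset.range N, (1 / 2 : ℝ) ^ n ≤
      ∑ n ∈ Finset.range N, w n := by
    induction N, hN using Nat.le_induction with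
    | base =>
      have : 0 ≤ ∑ n ∈ Finset.range N0, (1 / 2 : ℝ) ^ n :=
        Finset.sum_nonneg (fun i _ => by positivity)
      linarith
    | succ N hN ih =>
      rw [Finset.sum_range_succ, Finset.sum_range_succ]
      have := hN0 N hN
      linarith
  have := sum_geometric_two_le N
  linarith

theorem wStep {G : Set ℂ} (hG : IsOpen G) {E : Set (ℂ × ℂ)}
    (h : ∀ D : Set ℂ, IsOpen D → IsConnected D → IsCompact (closure D) → closure D ⊆ G →
        CompletePluripolarIn (E ∩ (D ×ˢ (Set.univ : Set ℂ)))
          (D ×ˢ (Set.univ : Set ℂ)))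
    {ρ : ℂ × ℂ → ℝ} (hρc : ContinuousOn ρ (G ×ˢ (univ : Set ℂ)))
    (hρ : RSM ρ (G ×ˢ (univ : Set ℂ)))
    (hρk : ∀ j : ℝ, IsCompact {x ∈ G ×ˢ (univ : Set ℂ) | ρ x ≤ j})
    {F C : Set (ℂ × ℂ)} (hF : IsClosed F) (hFE : F ⊆ E) (hC : IsClosed C) (hCE : C ⊆ Eᶜ)
    (j : ℕ) {ε : ℝ} (hε : 0 < ε) :
    ∃ w : ℂ × ℂ → ℝ, RSM w (G ×ˢ (univ : Set ℂ)) ∧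
      (∀ x ∈ G ×ˢ (univ : Set ℂ), ρ x ≤ j → w x ≤ 0) ∧
      (∀ x ∈ G ×ˢ (univ : Set ℂ), ρ x ≤ j → x ∈ F → w x ≤ -1) ∧
      (∀ x ∈ G ×ˢ (univ : Set ℂ), ρ x ≤ j → x ∈ C → -ε ≤ w x) := by
  set Ω := G ×ˢ (univ : Set ℂ) with hΩdef
  have hΩ : IsOpen Ω := hG.prod isOpen_univ
  set K := {x ∈ Ω | ρ x ≤ (j : ℝ) + 1} with hKdef
  have hK : IsCompact K := hρk _
  obtain ⟨U, hU, hKU, hUG, hUc⟩ := exists_open_between_and_isCompact_closure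
    (hK.image continuous_fst) hG (by rintro _ ⟨x, hx, rfl⟩; exact hx.1.1)
  obtain ⟨u, hu, huE⟩ := components h hU hUc hUG
  have hKsub : K ⊆ U ×ˢ (univ : Set ℂ) := fun x hx => ⟨hKU ⟨x, hx, rfl⟩, mem_univ _⟩
  obtain ⟨H, hH1, hH2, hH3, hH4⟩ := compactStep (hU.prod isOpen_univ) hu hK hKsub
    (hK.inter_left hF) inter_subset_right
    (fun x hx => (huE x (hKsub hx.2)).2 (hFE hx.1))
    (hK.inter_left hC) inter_subset_right
    (fun x hx hb => hCE hx.1 ((huE x (hKsub hx.2)).1 hb)) hε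
  have hg := RSM.glue hΩ hρ hρc ((j : ℝ) + 1) (H := H)
    (hH1.mono (fun x hx => ⟨hx.1, hx.2.le⟩)) (fun x hx hlt => hH2 x ⟨hx, hlt.le⟩)
  refine ⟨_, hg, ?_, ?_, ?_⟩
  · intro x hx hxj
    have hlt : ρ x < (j : ℝ) + 1 := by linarith
    simp only [hlt, if_true]
    exact max_le (hH2 x ⟨hx, hlt.le⟩) (by linarith)
  · intro x hx hxj hxF
    have hlt : ρ x < (j : ℝ) + 1 := by linarith
    simp only [hlt, if_true]
    exact max_le (hH3 x ⟨hxF, hx, hlt.le⟩) (by linarith)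
  · intro x hx hxj hxC
    have hlt : ρ x < (j : ℝ) + 1 := by linarith
    simp only [hlt, if_true]
    exact (hH4 x ⟨hxC, hx, hlt.le⟩).trans (le_max_left _ _)

theorem backward {G : Set ℂ} {E : Set (ℂ × ℂ)}
    (hG : IsOpen G)
    (hEpp : PluripolarIn E (G ×ˢ (Set.univ : Set ℂ)))
    (hFs : ∃ F : ℕ → Set (ℂ × ℂ), (∀ n, IsClosed (F n)) ∧ E = ⋃ n, F n)
    (hGd : IsGδ E)
    (h : ∀ D : Set ℂ, IsOpen D → IsConnected D → IsCompact (closure D) → closure D ⊆ G →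
        CompletePluripolarIn (E ∩ (D ×ˢ (Set.univ : Set ℂ)))
          (D ×ˢ (Set.univ : Set ℂ))) :
    CompletePluripolarIn E (G ×ˢ (Set.univ : Set ℂ)) := by
  obtain ⟨ρ, hρc, hρ, hρk⟩ := exhaustion hG
  obtain ⟨F, hF, hFE⟩ := hFs
  obtain ⟨V, hV, hVE⟩ := isGδ_iff_eq_iInter_nat.1 hGd
  set Ω := G ×ˢ (univ : Set ℂ) with hΩdef
  have hex : ∀ j : ℕ, ∃ w : ℂ × ℂ → ℝ, RSM w Ω ∧
      (∀ x ∈ Ω, ρ x ≤ j → w x ≤ 0) ∧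
      (∀ x ∈ Ω, ρ x ≤ j → x ∈ (⋃ n ∈ Finset.range j, F n) → w x ≤ -1) ∧
      (∀ x ∈ Ω, ρ x ≤ j → x ∈ (⋃ n ∈ Finset.range j, (V n)ᶜ) → -(1 / 2 : ℝ) ^ j ≤ w x) := by
    intro j
    refine wStep hG h hρc hρ hρk ?_ ?_ ?_ ?_ j (by positivity)
    · exact isClosed_biUnion_finset (fun n _ => hF n)
    · rw [hFE]
      exact iUnion₂_subset (fun n _ => subset_iUnion F n)
    · exact isClosed_biUnion_finset (fun n _ => (hV n).isClosed_compl)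
    · refine iUnion₂_subset (fun n _ => compl_subset_compl.2 ?_)
      rw [hVE]
      exact iInter_subset V n
  choose w hw1 hw2 hw3 hw4 using hex
  obtain ⟨W, hW, hWb, hWn⟩ := series hw1 hρc hw2
  have hev : ∀ x : ℂ × ℂ, ∀ᶠ j : ℕ in atTop, ρ x ≤ j := fun x =>
    tendsto_natCast_atTop_atTop.eventually_ge_atTop (ρ x)
  have hB : ∀ x ∈ Ω, x ∈ E → W x = ⊥ := by
    intro x hx hxE
    rw [hFE] at hxE
    obtain ⟨n, hn⟩ := mem_iUnion.1 hxE
    refine hWb x hx (sums_atBot ?_)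
    filter_upwards [hev x, eventually_gt_atTop n] with j hj hnj
    exact hw3 j x hx hj (mem_biUnion (Finset.mem_coe.2 (Finset.mem_range.2 hnj)) hn)
  have hN : ∀ x ∈ Ω, x ∉ E → W x ≠ ⊥ := by
    intro x hx hxE
    rw [hVE] at hxE
    obtain ⟨n, hn⟩ : ∃ n, x ∉ V n := by
      by_contra! hc
      exact hxE (mem_iInter.2 hc)
    refine hWn x hx (sums_bddBelow ?_)
    filter_upwards [hev x, eventually_gt_atTop n] with j hj hnj
    exact hw4 j x hx hj (mem_biUnion (Finset.mem_coe.2 (Finset.mem_range.2 hnj)) hn)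
  refine ⟨W, ⟨hW.top, hW.usc, ?_, hW.sm⟩, fun x hx => ⟨fun hb => ?_, hB x hx⟩⟩
  · intro z hz
    obtain ⟨u, hu, huE⟩ := hEpp
    obtain ⟨p, hp, hpu⟩ := hu.2.2.1 z hz
    exact ⟨p, hp, hN p (connectedComponentIn_subset _ _ hp) (fun hpE => hpu (huE p hpE))⟩
  · by_contra hxE
    exact hN x hx hxE hb

theorem bot_spread {X : Type*} [NormedAddCommGroup X] [NormedSpace ℂ X] {u : X → EReal}
    {Ω : Set X} (hu : ESM u Ω) {x q : X} (hd : ∀ l ∈ closedBall (0 : ℂ) 1, x + l • (q - x) ∈ Ω)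
    (hq : ∀ᶠ y in 𝓝 q, u y = ⊥) : u x = ⊥ := by
  have h1 := hu.sm x (q - x) 0 1 one_pos hd
  rw [zero_smul, add_zero] at h1
  unfold circleAvg at h1
  split_ifs at h1 with hc
  · exfalso
    have hae := hc.2
    have hcont : Continuous (fun θ : ℝ => x + circleMap 0 1 θ • (q - x)) :=
      (line_cont x (q - x)).comp (continuous_circleMap 0 1)
    have h0 : ∀ᶠ θ in 𝓝 (0 : ℝ), u (x + circleMap 0 1 θ • (q - x)) = ⊥ := by
      refine (hcont.continuousAt (x := 0)).eventually (p := fun y => u y = ⊥) ?_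
      simpa [circleMap] using hq
    obtain ⟨δ, hδ, hδ'⟩ := Metric.eventually_nhds_iff.1 h0
    rw [ae_iff] at hae
    have hpi := Real.two_pi_pos
    have hsub : Ioo 0 (min δ (2 * Real.pi)) ⊆
        {a | ¬ u (x + circleMap 0 1 a • (q - x)) ≠ ⊥} := by
      intro θ hθ
      simp only [ne_eq, not_not, mem_ofPred_eq]
      apply hδ'
      rw [Real.dist_eq, sub_zero, abs_of_pos hθ.1]
      exact hθ.2.trans_le (min_le_left _ _)
    have h3 := measure_mono_null hsub hae
    rw [Measure.restrict_apply measurableSet_Ioo, inter_eq_self_of_subset_left] at h3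
    · rw [Real.volume_Ioo, ENNReal.ofReal_eq_zero, sub_zero] at h3
      exact absurd h3 (not_le.2 (lt_min hδ hpi))
    · intro θ hθ
      exact ⟨hθ.1, (hθ.2.trans_le (min_le_right _ _)).le⟩
  · exact le_bot_iff.1 h1

theorem bot_everywhere {X : Type*} [NormedAddCommGroup X] [NormedSpace ℂ X] {u : X → EReal}
    {Ω : Set X} (hΩ : IsOpen Ω) (hconn : IsPreconnected Ω) (hu : ESM u Ω) {q : X} (hqΩ : q ∈ Ω)
    (hq : ∀ᶠ y in 𝓝 q, u y = ⊥) : ∀ x ∈ Ω, u x = ⊥ := by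
  have hop : IsOpen {x | ∀ᶠ y in 𝓝 x, u y = ⊥} := isOpen_setOfPred_eventually_nhds
  have hsub : Ω ⊆ {x | ∀ᶠ y in 𝓝 x, u y = ⊥} := by
    apply hconn.subset_of_closure_inter_subset hop ⟨q, hqΩ, hq⟩
    rintro p ⟨hp, hpΩ⟩
    obtain ⟨R, hR, hRΩ⟩ := Metric.isOpen_iff.1 hΩ p hpΩ
    obtain ⟨q', hq', hq'd⟩ := Metric.mem_closure_iff.1 hp (R / 3) (by positivity)
    have : ball p (R / 3) ∈ 𝓝 p := ball_mem_nhds p (by positivity)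
    show ∀ᶠ y in 𝓝 p, u y = ⊥
    filter_upwards [this] with x hx
    refine bot_spread hu (fun l hl => hRΩ ?_) hq'
    rw [mem_closedBall, dist_zero_right] at hl
    rw [mem_ball, dist_eq_norm] at hx ⊢
    rw [dist_comm, dist_eq_norm] at hq'd
    have e1 : ‖l • (q' - x)‖ ≤ ‖q' - x‖ := by
      rw [norm_smul]
      exact mul_le_of_le_one_left (norm_nonneg _) hl
    have e2 : ‖q' - x‖ ≤ ‖q' - p‖ + ‖x - p‖ := by
      have := norm_sub_le (q' - p) (x - p)
      rwa [sub_sub_sub_cancel_right] at this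
    have e3 : ‖x + l • (q' - x) - p‖ ≤ ‖x - p‖ + ‖l • (q' - x)‖ := by
      rw [add_sub_right_comm]
      exact norm_add_le _ _
    linarith
  intro x hx
  exact (hsub hx).self_of_nhds

theorem forward {G D : Set ℂ} {E : Set (ℂ × ℂ)} (hG : IsOpen G) (hGconn : IsConnected G)
    (h : CompletePluripolarIn E (G ×ˢ (Set.univ : Set ℂ)))
    (hD : IsOpen D) (hDG : D ⊆ G) :
    CompletePluripolarIn (E ∩ (D ×ˢ (Set.univ : Set ℂ))) (D ×ˢ (Set.univ : Set ℂ)) := by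
  obtain ⟨u, ⟨h1, h2, h3, h4⟩, hE⟩ := h
  have hsub : D ×ˢ (Set.univ : Set ℂ) ⊆ G ×ˢ (Set.univ : Set ℂ) := prod_mono_left hDG
  refine ⟨u, ⟨fun z hz => h1 z (hsub hz), h2.mono hsub, fun z hz => ?_,
    fun a b c r hr hd => h4 a b c r hr (fun l hl => hsub (hd l hl))⟩,
    fun z hz => (hE z (hsub hz)).trans ⟨fun h => ⟨h, hz⟩, fun h => h.1⟩⟩
  by_contra! hcon
  have hop : IsOpen (connectedComponentIn (D ×ˢ (Set.univ : Set ℂ)) z) :=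
    (hD.prod isOpen_univ).connectedComponentIn
  have hq : ∀ᶠ y in 𝓝 z, u y = ⊥ := by
    filter_upwards [hop.mem_nhds (mem_connectedComponentIn hz)] with y hy using hcon y hy
  have hall := bot_everywhere (hG.prod isOpen_univ) (hGconn.isPreconnected.prod isPreconnected_univ)
    ⟨h1, h2, h4⟩ (hsub hz) hq
  obtain ⟨p, hp, hpu⟩ := h3 z (hsub hz)
  exact hpu (hall p (connectedComponentIn_subset _ _ hp))

end

/-- Let `G ⊆ ℂ` be a domain and `E ⊆ G × ℂ` pluripolar, both `F_σ` and
`G_δ`. Then `E` is complete pluripolar in `G × ℂ` iff `E ∩ (D × ℂ)` is complete pluripolar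
in `D × ℂ` for every subdomain `D ⋐ G`. -/
theorem statement10 (G : Set ℂ) (E : Set (ℂ × ℂ))
    (hG : IsOpen G) (hGconn : IsConnected G)
    (hEsub : E ⊆ G ×ˢ (Set.univ : Set ℂ))
    (hEpp : PluripolarIn E (G ×ˢ (Set.univ : Set ℂ)))
    (hFσ : ∃ F : ℕ → Set (ℂ × ℂ), (∀ n, IsClosed (F n)) ∧ E = ⋃ n, F n)
    (hGδ : IsGδ E) :
    CompletePluripolarIn E (G ×ˢ (Set.univ : Set ℂ)) ↔
      ∀ D : Set ℂ, IsOpen D → IsConnected D → IsCompact (closure D) → closure D ⊆ G →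
        CompletePluripolarIn (E ∩ (D ×ˢ (Set.univ : Set ℂ)))
          (D ×ˢ (Set.univ : Set ℂ)) := by
  constructor
  · intro h D hD _ _ hDG
    exact forward hG hGconn h hD (subset_closure.trans hDG)
  · intro h
    exact backward hG hEpp hFσ hGδ h
end
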